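/- arXiv:math/0204063 — 2 statements merged into one kernel-verified Lean document; each statement's English description precedes it below -/
import Mathlib

section
/- (Thickness Formula for curves in ℝⁿ.) For every knot γ in ℝⁿ (n ≥ 2), i.e. every simple closed unit-speed C^{1,1} curve, with image K, one has i(K,ℝⁿ) = R_O(K) = min{F_k(γ), MDC(K)/2}. -/
open Set Filter MeasureTheory
open scoped RealInnerProductSpace Topology ENNReal

noncomputable section

/-- Euclidean space `ℝⁿ`. -/
abbrev Euc (n : ℕ) := EuclideanSpace ℝ (Fin n)

/-- Generalized curvature `κγ(s)` of a curve with derivative `γd` and parameter domain `D`: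
the limsup, as `x, y → s` with `x ≠ y`, of `∠(γd x, γd y) / |x - y|`, expressed as the
infimum of all eventual bounds. -/
def curvAt {n : ℕ} (γd : ℝ → Euc n) (D : Set ℝ) (s : ℝ) : ℝ :=
  sInf {Λ : ℝ | 0 ≤ Λ ∧ ∃ δ > 0, ∀ x ∈ D, ∀ y ∈ D, x ≠ y →
    |x - s| < δ → |y - s| < δ →
    InnerProductGeometry.angle (γd x) (γd y) ≤ Λ * |x - y|}

/-- `κγ(s) < Λ`: there are `δ > 0` and `Λ' < Λ` bounding the angle dilation near `s`. -/
def CurvLt {n : ℕ} (γd : ℝ → Euc n) (D : Set ℝ) (s Λ : ℝ) : Prop :=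
  ∃ δ > 0, ∃ Λ' < Λ, ∀ x ∈ D, ∀ y ∈ D, x ≠ y → |x - s| < δ → |y - s| < δ →
    InnerProductGeometry.angle (γd x) (γd y) ≤ Λ' * |x - y|

/-- `f` restricted to `[a, c]` is a planar circular arc of radius `1/Λ`
of length in `[0, 2π/Λ)`. -/
def IsArc {n : ℕ} (Λ : ℝ) (f : ℝ → Euc n) (a c : ℝ) : Prop :=
  c - a < 2 * Real.pi / Λ ∧
  ∃ (o u e : Euc n) (s₁ : ℝ), ‖u‖ = 1 ∧ ‖e‖ = 1 ∧ ⟪u, e⟫ = 0 ∧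
    ∀ s ∈ Icc a c,
      f s = o + (Λ⁻¹ * Real.cos (Λ * (s - s₁))) • u + (Λ⁻¹ * Real.sin (Λ * (s - s₁))) • e

/-- `f` restricted to `[a, c]` is a planar circular arc of radius `r`. -/
def IsArcR {n : ℕ} (r : ℝ) (f : ℝ → Euc n) (a c : ℝ) : Prop :=
  ∃ (o u e : Euc n) (s₁ : ℝ), ‖u‖ = 1 ∧ ‖e‖ = 1 ∧ ⟪u, e⟫ = 0 ∧
    ∀ s ∈ Icc a c,
      f s = o + (r * Real.cos ((s - s₁) / r)) • u + (r * Real.sin ((s - s₁) / r)) • e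

/-- `O_p(v, r)`: the union of the open balls of radius `r` tangent to `v^⊥` at `p`. -/
def Odisk {n : ℕ} (p v : Euc n) (r : ℝ) : Set (Euc n) :=
  {x | ∃ w : Euc n, ‖w‖ = 1 ∧ ⟪w, v⟫ = 0 ∧ ‖x - p - r • w‖ < r}

/-- Ball radius `R_O` of the curve `f` (with derivative/tangent field `γd`) on domain `D`. -/
def RO {n : ℕ} (f γd : ℝ → Euc n) (D : Set ℝ) : ℝ :=
  sInf {r : ℝ | 0 < r ∧ ∃ s ∈ D, ∃ t ∈ D, ∃ w : Euc n,
    ‖w‖ = 1 ∧ ⟪w, γd s⟫ = 0 ∧ ‖f t - f s - r • w‖ < r}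

/-- Minimal double critical distance of the curve `f` with tangent field `γd`. -/
def MDC {n : ℕ} (f γd : ℝ → Euc n) : ℝ :=
  sInf {d : ℝ | ∃ x y : ℝ, f x ≠ f y ∧ ⟪f x - f y, γd x⟫ = 0 ∧
    ⟪f x - f y, γd y⟫ = 0 ∧ d = ‖f x - f y‖}

/-- Normal injectivity radius `i(K, ℝⁿ)` of the curve `f` with tangent field `γd`. -/
def injRad {n : ℕ} (f γd : ℝ → Euc n) : ℝ :=
  sSup ({0} ∪ {r : ℝ | 0 < r ∧ ∀ s t : ℝ, ∀ u w : Euc n,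
    ⟪u, γd s⟫ = 0 → ⟪w, γd t⟫ = 0 → ‖u‖ < r → ‖w‖ < r →
    f s + u = f t + w → f s = f t ∧ u = w})

/-- A knot: a simple closed unit-speed `C^{1,1}` curve, as an `L`-periodic map `ℝ → ℝⁿ`,
injective on `[0, L)`, with `‖γ'‖ ≡ 1` and `γ'` Lipschitz. -/
structure Knot (n : ℕ) where
  L : ℝ
  Lpos : 0 < L
  f : ℝ → Euc n
  fd : ℝ → Euc n
  per : ∀ s, f (s + L) = f s
  perd : ∀ s, fd (s + L) = fd s
  deriv : ∀ s, HasDerivAt f (fd s) s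
  unit : ∀ s, ‖fd s‖ = 1
  lipd : ∃ C : NNReal, LipschitzWith C fd
  inj : InjOn f (Ico 0 L)

/-- Ropelength `ℓ_e(γ) = L / R_O(K)`. -/
def Knot.ropelength {n : ℕ} (k : Knot n) : ℝ := k.L / RO k.f k.fd univ

/-- The set `I_c` of parameters realizing the minimal double critical distance. -/
def Knot.Ic {n : ℕ} (k : Knot n) : Set ℝ :=
  {x | ∃ y : ℝ, k.f x ≠ k.f y ∧ ⟪k.f x - k.f y, k.fd x⟫ = 0 ∧
    ⟪k.f x - k.f y, k.fd y⟫ = 0 ∧ ‖k.f x - k.f y‖ = MDC k.f k.fd}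

/-- `sup_s κγ(s)` for a knot. -/
def Knot.supCurv {n : ℕ} (k : Knot n) : ℝ := ⨆ s : ℝ, curvAt k.fd univ s

/-- Analytic focal distance `F_k(γ) = (sup_s κγ(s))⁻¹`. -/
def Knot.Fk {n : ℕ} (k : Knot n) : ℝ := (k.supCurv)⁻¹

/-- Two knots are in the same knot class: after rescaling their domains to `ℝ/ℤ`
(realized by `1`-periodic maps `ℝ → ℝⁿ`), they are joined by a continuous homotopy
through injective loops. -/
def SameKnotClass {n : ℕ} (k₁ k₂ : Knot n) : Prop :=
  ∃ H : ℝ → ℝ → Euc n,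
    ContinuousOn (fun z : ℝ × ℝ => H z.1 z.2) (Icc 0 1 ×ˢ univ) ∧
    (∀ t s, H t (s + 1) = H t s) ∧
    (∀ s, H 0 s = k₁.f (k₁.L * s)) ∧
    (∀ s, H 1 s = k₂.f (k₂.L * s)) ∧
    ∀ t ∈ Icc (0 : ℝ) 1, InjOn (H t) (Ico 0 1)

/-- A knot is relatively extremal: a relative minimum of ropelength within its knot class
with respect to the `C¹` topology (on rescaled parametrizations). -/
def RelativelyExtremal {n : ℕ} (k : Knot n) : Prop :=
  ∃ ε > 0, ∀ η : Knot n, SameKnotClass k η →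
    (∀ s : ℝ, ‖η.f (η.L * s) - k.f (k.L * s)‖ +
      ‖η.L • η.fd (η.L * s) - k.L • k.fd (k.L * s)‖ < ε) →
    k.ropelength ≤ η.ropelength

/-- The class `C(p, q; v, w; Λ)`: unit-speed `C^{1,1}` curves `γ : [0, L] → ℝⁿ`
(`L` not fixed) from `p` to `q` with initial/terminal directions `v, w`
and `Λ`-Lipschitz derivative (curvature at most `Λ`). -/
structure CurveCC (n : ℕ) (p q v w : Euc n) (Λ : ℝ) where
  L : ℝ
  Lnn : 0 ≤ L
  f : ℝ → Euc n
  fd : ℝ → Euc n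
  deriv : ∀ s ∈ Icc (0 : ℝ) L, HasDerivWithinAt f (fd s) (Icc 0 L) s
  unit : ∀ s ∈ Icc (0 : ℝ) L, ‖fd s‖ = 1
  lip : LipschitzOnWith Λ.toNNReal fd (Icc 0 L)
  i0 : f 0 = p
  id0 : fd 0 = v
  iL : f L = q
  idL : fd L = w

/-- A `C¹` closed curve of period `L` with nowhere-vanishing derivative. -/
structure ClosedC1 (n : ℕ) (L : ℝ) where
  f : ℝ → Euc n
  fd : ℝ → Euc n
  per : ∀ s, f (s + L) = f s
  perd : ∀ s, fd (s + L) = fd s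
  deriv : ∀ s, HasDerivAt f (fd s) s
  nz : ∀ s, fd s ≠ 0

/-- A simple closed `C^{1,1}` curve of period `L` with nowhere-vanishing derivative. -/
structure ClosedC11 (n : ℕ) (L : ℝ) extends ClosedC1 n L where
  lipd : ∃ C : NNReal, LipschitzWith C fd
  inj : InjOn f (Ico 0 L)

/-- The unit tangent field of `c` is `C`-Lipschitz with respect to the arclength of `c`. -/
def TangentLip {n : ℕ} {L : ℝ} (c : ClosedC1 n L) (C : ℝ) : Prop :=
  ∀ x y : ℝ, x ≤ y →
    ‖‖c.fd y‖⁻¹ • c.fd y - ‖c.fd x‖⁻¹ • c.fd x‖ ≤ C * ∫ t in x..y, ‖c.fd t‖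

/-- Pointwise geometric focal distance `F_g(γ(s))` of the curve `f` with domain `D`. -/
def FgPt {n : ℕ} (f fd : ℝ → Euc n) (D : Set ℝ) (s : ℝ) : ℝ :=
  sInf {r : ℝ | 0 < r ∧ f s ∈ closure (Odisk (f s) (fd s) r ∩ (f '' D))}

end

theorem norm_sub_sq_of_unit {n : ℕ} {x y : Euc n} (hx : ‖x‖ = 1) (hy : ‖y‖ = 1) :
    ‖x - y‖ ^ 2 = 2 - 2 * ⟪x, y⟫ := by
  rw [norm_sub_sq_real, hx, hy]; ring

theorem norm_sub_eq_two_mul_sin_half_angle {n : ℕ} {x y : Euc n} (hx : ‖x‖ = 1) (hy : ‖y‖ = 1) :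
    ‖x - y‖ = 2 * Real.sin (InnerProductGeometry.angle x y / 2) := by
  have h0 := InnerProductGeometry.angle_nonneg x y
  have h1 := InnerProductGeometry.angle_le_pi x y
  have hs : 0 ≤ Real.sin (InnerProductGeometry.angle x y / 2) :=
    Real.sin_nonneg_of_nonneg_of_le_pi (by linarith) (by linarith)
  have hc : Real.cos (InnerProductGeometry.angle x y) =
      1 - 2 * Real.sin (InnerProductGeometry.angle x y / 2) ^ 2 := by
    have h := Real.cos_two_mul (InnerProductGeometry.angle x y / 2)
    have h' := Real.sin_sq_add_cos_sq (InnerProductGeometry.angle x y / 2)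
    rw [mul_div_cancel₀ _ (two_ne_zero)] at h
    linarith
  have h := norm_sub_sq_of_unit hx hy
  rw [InnerProductGeometry.inner_eq_cos_angle_of_norm_eq_one hx hy, hc] at h
  refine (sq_eq_sq₀ (norm_nonneg _) (by positivity)).1 ?_
  rw [h]; ring

theorem norm_sub_le_angle {n : ℕ} {x y : Euc n} (hx : ‖x‖ = 1) (hy : ‖y‖ = 1) :
    ‖x - y‖ ≤ InnerProductGeometry.angle x y := by
  rw [norm_sub_eq_two_mul_sin_half_angle hx hy]
  have := Real.sin_le (x := InnerProductGeometry.angle x y / 2)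
    (by linarith [InnerProductGeometry.angle_nonneg x y])
  linarith

theorem angle_le_norm_sub_add_cube {n : ℕ} {x y : Euc n} (hx : ‖x‖ = 1) (hy : ‖y‖ = 1) :
    InnerProductGeometry.angle x y ≤ ‖x - y‖ + ‖x - y‖ ^ 3 := by
  have h0 := InnerProductGeometry.angle_nonneg x y
  have h1 := InnerProductGeometry.angle_le_pi x y
  rw [norm_sub_eq_two_mul_sin_half_angle hx hy]
  generalize InnerProductGeometry.angle x y = θ at *
  rcases h0.eq_or_lt with rfl | hpos
  · simp
  have hA := Real.mul_le_sin (x := θ / 2) (by linarith) (by linarith)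
  have hB := Real.sin_gt_sub_cube (x := θ / 2) (by linarith)
  have hC : θ / 4 ≤ Real.sin (θ / 2) := by
    refine le_trans ?_ hA
    have : (1 : ℝ) / 2 ≤ 2 / Real.pi := by
      rw [div_le_div_iff₀ (by norm_num) Real.pi_pos]; linarith [Real.pi_le_four]
    nlinarith
  have hD : (θ / 4) ^ 3 ≤ Real.sin (θ / 2) ^ 3 := pow_le_pow_left₀ (by linarith) hC 3
  rw [mul_pow]
  linarith [pow_pos hpos 3, div_pow θ 2 3, div_pow θ 4 3]

/-- Mean value inequality, with the derivative bound only needed within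
distance `|t - s|` of `s`. -/
theorem norm_le_of_norm_deriv_le {E : Type*} [NormedAddCommGroup E] [NormedSpace ℝ E]
    {g g' : ℝ → E} {s t C : ℝ} (hg : ∀ x, HasDerivAt g (g' x) x)
    (hb : ∀ x, |x - s| ≤ |t - s| → ‖g' x‖ ≤ C) : ‖g t - g s‖ ≤ C * |t - s| := by
  have := Convex.norm_image_sub_le_of_norm_hasDerivWithin_le (𝕜 := ℝ) (f := g) (f' := g')
    (s := Metric.closedBall s |t - s|) (x := s) (y := t) (C := C)
    (fun x _ => (hg x).hasDerivWithinAt)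
    (fun x hx => hb x (by simpa [Real.dist_eq] using hx)) (convex_closedBall _ _)
    (by simp) (by simp [Real.dist_eq])
  simpa [Real.norm_eq_abs] using this

theorem norm_le_half_sq_of_norm_deriv_le {E : Type*} [NormedAddCommGroup E] [NormedSpace ℝ E]
    {g g' : ℝ → E} {C : ℝ} (hg : ∀ x, HasDerivAt g (g' x) x) (h0 : g 0 = 0)
    (hb : ∀ x, ‖g' x‖ ≤ C * |x|) (h : ℝ) : ‖g h‖ ≤ C / 2 * h ^ 2 := by
  have key : ∀ {k k' : ℝ → E}, (∀ x, HasDerivAt k (k' x) x) → k 0 = 0 →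
      (∀ x, ‖k' x‖ ≤ C * |x|) → ∀ h, 0 ≤ h → ‖k h‖ ≤ C / 2 * h ^ 2 := by
    intro k k' hk k0 kb h hh
    refine image_norm_le_of_norm_deriv_right_le_deriv_boundary (f := k) (f' := k') (a := 0) (b := h)
      (B := fun x => C / 2 * x ^ 2) (B' := fun x => C * x)
      (fun x _ => (hk x).continuousAt.continuousWithinAt)
      (fun x _ => (hk x).hasDerivWithinAt) (by simp [k0]) (fun x => ?_) (fun x hx => ?_)
      (right_mem_Icc.2 hh)
    · exact ((hasDerivAt_pow 2 x).const_mul (C / 2)).congr_deriv (by push_cast; ring)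
    · simpa [abs_of_nonneg hx.1] using kb x
  rcases le_total 0 h with hh | hh
  · exact key hg h0 hb h hh
  · have := key (k := fun x => g (-x)) (k' := fun x => -g' (-x))
      (fun x => ((hg (-x)).scomp x (hasDerivAt_neg x)).congr_deriv (by simp)) (by simpa using h0)
      (fun x => by simpa using hb (-x)) (-h) (by linarith)
    simpa using this

namespace Knot

variable {n : ℕ} (γ : Knot n)

theorem f_add_int (s : ℝ) (m : ℤ) : γ.f (s + m • γ.L) = γ.f s := by
  have h : Function.Periodic γ.f γ.L := γ.per
  exact h.zsmul m s

theorem fd_add_int (s : ℝ) (m : ℤ) : γ.fd (s + m • γ.L) = γ.fd s := by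
  have h : Function.Periodic γ.fd γ.L := γ.perd
  exact h.zsmul m s

theorem eq_of_f_eq {x y : ℝ} (h : γ.f x = γ.f y) (hxy : |x - y| < γ.L) : x = y := by
  obtain ⟨m, hm, -⟩ := existsUnique_add_zsmul_mem_Ico γ.Lpos x 0
  obtain ⟨k, hk, -⟩ := existsUnique_add_zsmul_mem_Ico γ.Lpos y 0
  simp only [zero_add] at hm hk
  have e := γ.inj hm hk (by rw [f_add_int, f_add_int, h])
  have e' : x - y = ((k - m : ℤ) : ℝ) * γ.L := by
    simp only [zsmul_eq_mul] at e; push_cast; linarith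
  rw [e', abs_mul, abs_of_pos γ.Lpos] at hxy
  have h1 : |((k - m : ℤ) : ℝ)| < 1 := by
    have := γ.Lpos
    by_contra! hc
    nlinarith
  have h2 : k - m = 0 := by
    rw [← Int.cast_abs] at h1
    exact Int.abs_lt_one_iff.1 (by exact_mod_cast h1)
  rw [h2] at e'
  simp at e'
  linarith

theorem continuous_f : Continuous γ.f :=
  continuous_iff_continuousAt.2 fun s => (γ.deriv s).continuousAt

theorem continuous_fd : Continuous γ.fd := by
  obtain ⟨C, hC⟩ := γ.lipd
  exact hC.continuous

theorem norm_f_sub_le (s t : ℝ) : ‖γ.f t - γ.f s‖ ≤ |t - s| := by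
  simpa using norm_le_of_norm_deriv_le (C := 1) (s := s) (t := t) γ.deriv
    (fun x _ => (γ.unit x).le)

theorem norm_fd_sub_le {K : NNReal} (hK : LipschitzWith K γ.fd) (s t : ℝ) :
    ‖γ.fd t - γ.fd s‖ ≤ K * |t - s| := by
  simpa [dist_eq_norm] using hK.dist_le_mul t s

theorem norm_taylor_le {K : NNReal} (hK : LipschitzWith K γ.fd) (s t : ℝ) :
    ‖γ.f t - γ.f s - (t - s) • γ.fd s‖ ≤ K / 2 * (t - s) ^ 2 := by
  have := norm_le_half_sq_of_norm_deriv_le (g := fun h => γ.f (s + h) - γ.f s - h • γ.fd s)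
    (g' := fun h => γ.fd (s + h) - γ.fd s) (C := K) (fun x => ?_) (by simp) (fun x => ?_) (t - s)
  · simpa using this
  · have h1 := ((γ.deriv (s + x)).comp_const_add s x).sub_const (γ.f s)
    exact (h1.fun_sub ((hasDerivAt_id x).smul_const (γ.fd s))).congr_deriv (by simp)
  · simpa using γ.norm_fd_sub_le hK s (s + x)

/-- The tangential component of a chord agrees with its arclength to third order. -/
theorem abs_inner_sub_le {K : NNReal} (hK : LipschitzWith K γ.fd) (s t : ℝ) :
    |⟪γ.f t - γ.f s, γ.fd s⟫ - (t - s)| ≤ K ^ 2 / 2 * |t - s| ^ 3 := by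
  have := norm_le_of_norm_deriv_le (g := fun x => ⟪γ.f x - γ.f s, γ.fd s⟫ - (x - s))
    (g' := fun x => ⟪γ.fd x, γ.fd s⟫ - 1) (s := s) (t := t) (C := K ^ 2 / 2 * |t - s| ^ 2)
    (fun x => ?_) (fun x hx => ?_)
  · simp only [sub_self, inner_zero_left, sub_zero, Real.norm_eq_abs] at this
    exact this.trans_eq (by ring)
  · have h1 := (((γ.deriv x).sub_const (γ.f s)).inner ℝ (hasDerivAt_const x (γ.fd s))).fun_sub
      ((hasDerivAt_id x).sub_const s)
    exact h1.congr_deriv (by simp)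
  · have h1 := norm_sub_sq_of_unit (γ.unit x) (γ.unit s)
    have h2 := (γ.norm_fd_sub_le hK s x).trans (mul_le_mul_of_nonneg_left hx K.2)
    have h3 := pow_le_pow_left₀ (norm_nonneg _) h2 2
    have h4 := sq_nonneg ‖γ.fd x - γ.fd s‖
    rw [Real.norm_eq_abs, abs_le]
    constructor <;> nlinarith

/-- Quadratic growth of the distance to a point of the normal disk within focal distance. -/
theorem exists_quadratic_growth {K : NNReal} (hK : LipschitzWith K γ.fd) {a : ℝ} (ha : 0 ≤ a)
    (haK : a * K < 1) : ∃ δ > 0, ∃ m > 0, ∀ s t : ℝ, |t - s| ≤ δ → ∀ u : Euc n,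
      ⟪u, γ.fd s⟫ = 0 → ‖u‖ ≤ a →
      ‖u‖ ^ 2 + m * (t - s) ^ 2 ≤ ‖γ.f t - γ.f s - u‖ ^ 2 := by
  have hK0 : (0 : ℝ) ≤ K := K.2
  refine ⟨(1 - a * K) / (2 * (K + 1)), div_pos (by linarith) (by positivity),
    (1 - a * K) / 2, by linarith, fun s t hst u hu hua => ?_⟩
  set d := γ.f t - γ.f s with hd
  set h := t - s with hh
  have ht : ‖d - h • γ.fd s‖ ≤ K / 2 * h ^ 2 := γ.norm_taylor_le hK s t
  have hin : ⟪d, u⟫ ≤ K / 2 * h ^ 2 * a := by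
    have e : ⟪d, u⟫ = ⟪d - h • γ.fd s, u⟫ := by
      rw [inner_sub_left d, real_inner_smul_left, real_inner_comm u (γ.fd s), hu]; simp
    rw [e]
    exact (real_inner_le_norm _ _).trans
      (mul_le_mul ht hua (norm_nonneg _) (by positivity))
  have hlow : |h| * (1 - K / 2 * |h|) ≤ ‖d‖ := by
    have h1 : ‖h • γ.fd s‖ - ‖d - h • γ.fd s‖ ≤ ‖d‖ := by
      have := norm_sub_norm_le (h • γ.fd s) (h • γ.fd s - d)
      rw [sub_sub_cancel, norm_sub_rev (h • γ.fd s) d] at this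
      exact this
    rw [norm_smul, γ.unit, Real.norm_eq_abs, mul_one] at h1
    rw [← sq_abs] at ht
    nlinarith
  have hKh : K * |h| ≤ (1 - a * K) / 2 := by
    rw [le_div_iff₀ (by positivity)] at hst
    nlinarith [abs_nonneg h]
  have h1 : 0 ≤ 1 - K / 2 * |h| := by nlinarith [mul_nonneg ha hK0]
  have h2 := pow_le_pow_left₀ (by positivity) hlow 2
  have h3 : 1 - K * |h| ≤ (1 - K / 2 * |h|) ^ 2 := by nlinarith [sq_nonneg (K / 2 * |h|)]
  rw [mul_pow, sq_abs] at h2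
  have h4 := mul_le_mul_of_nonneg_left h3 (sq_nonneg h)
  rw [norm_sub_sq_real]
  nlinarith [sq_nonneg h, mul_le_mul_of_nonneg_left hKh (sq_nonneg h)]

end Knot

theorem norm_sub_smul_lt_iff {n : ℕ} {d w : Euc n} {r : ℝ} (hr : 0 < r) (hw : ‖w‖ = 1) :
    ‖d - r • w‖ < r ↔ ‖d‖ ^ 2 < 2 * r * ⟪d, w⟫ := by
  rw [← sq_lt_sq₀ (norm_nonneg _) hr.le, norm_sub_sq_real, real_inner_smul_right, norm_smul, hw,
    mul_one, Real.norm_eq_abs, sq_abs]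
  constructor <;> intro h <;> linarith

namespace Knot

variable {n : ℕ} (γ : Knot n)

theorem RO_nonneg : 0 ≤ RO γ.f γ.fd univ := Real.sInf_nonneg fun _ h => h.1.le

theorem RO_le {r : ℝ} (hr : 0 < r) {s t : ℝ} {w : Euc n} (hw : ‖w‖ = 1) (hws : ⟪w, γ.fd s⟫ = 0)
    (h : ‖γ.f t - γ.f s - r • w‖ < r) : RO γ.f γ.fd univ ≤ r :=
  csInf_le ⟨0, fun _ h => h.1.le⟩ ⟨hr, s, mem_univ _, t, mem_univ _, w, hw, hws, h⟩

theorem two_mul_RO_mul_inner_le {s : ℝ} (t : ℝ) {w : Euc n} (hw : ‖w‖ = 1)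
    (hws : ⟪w, γ.fd s⟫ = 0) :
    2 * RO γ.f γ.fd univ * ⟪γ.f t - γ.f s, w⟫ ≤ ‖γ.f t - γ.f s‖ ^ 2 := by
  rcases le_or_gt ⟪γ.f t - γ.f s, w⟫ 0 with hi | hi
  · nlinarith [γ.RO_nonneg, sq_nonneg ‖γ.f t - γ.f s‖]
  by_contra! hc
  have h1 : ‖γ.f t - γ.f s‖ ^ 2 / (2 * ⟪γ.f t - γ.f s, w⟫) < RO γ.f γ.fd univ := by
    rw [div_lt_iff₀ (by positivity)]; linarith
  obtain ⟨r, hr1, hr2⟩ := exists_between h1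
  have hr : 0 < r := lt_of_le_of_lt (by positivity) hr1
  rw [div_lt_iff₀ (by positivity)] at hr1
  exact absurd (γ.RO_le hr hw hws ((norm_sub_smul_lt_iff hr hw).2 (by linarith))) (not_le.2 hr2)

theorem RO_le_norm_sub {s : ℝ} (t : ℝ) {w : Euc n} (hw : ‖w‖ = 1) (hws : ⟪w, γ.fd s⟫ = 0) :
    RO γ.f γ.fd univ ≤ ‖γ.f t - γ.f s - RO γ.f γ.fd univ • w‖ := by
  rcases γ.RO_nonneg.eq_or_lt with h | h
  · rw [← h]; positivity
  · by_contra! hc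
    exact absurd (γ.two_mul_RO_mul_inner_le t hw hws) (not_le.2 ((norm_sub_smul_lt_iff h hw).1 hc))

theorem two_mul_RO_mul_norm_normal_le (s t : ℝ) :
    2 * RO γ.f γ.fd univ * ‖γ.f t - γ.f s - ⟪γ.f t - γ.f s, γ.fd s⟫ • γ.fd s‖ ≤
      ‖γ.f t - γ.f s‖ ^ 2 := by
  set d := γ.f t - γ.f s with hd
  set q := d - ⟪d, γ.fd s⟫ • γ.fd s with hq
  rcases eq_or_ne q 0 with h0 | h0
  · rw [h0, norm_zero, mul_zero]; positivity
  have hqn : ‖q‖ ≠ 0 := norm_ne_zero_iff.2 h0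
  have hqs : ⟪q, γ.fd s⟫ = 0 := by
    rw [hq, inner_sub_left, real_inner_smul_left, real_inner_self_eq_norm_sq, γ.unit]; ring
  have hdq : ⟪d, q⟫ = ‖q‖ ^ 2 := by
    have : d = q + ⟪d, γ.fd s⟫ • γ.fd s := by rw [hq]; abel
    rw [this, inner_add_left, real_inner_smul_left, real_inner_comm q (γ.fd s), hqs,
      real_inner_self_eq_norm_sq]; ring
  have h := γ.two_mul_RO_mul_inner_le (s := s) t (w := ‖q‖⁻¹ • q)
    (by rw [norm_smul, norm_inv, norm_norm, inv_mul_cancel₀ hqn])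
    (by rw [real_inner_smul_left, hqs, mul_zero])
  rw [← hd, real_inner_smul_right, hdq] at h
  convert h using 2
  field_simp

/-- A lower bound on the ball radius makes the tangent field Lipschitz to leading order. -/
theorem norm_fd_sub_le_of_RO_pos {K : NNReal} (hK : LipschitzWith K γ.fd)
    (hR : 0 < RO γ.f γ.fd univ) (s t : ℝ) :
    ‖γ.fd t - γ.fd s‖ ≤ (RO γ.f γ.fd univ)⁻¹ * |t - s| + K ^ 2 * |t - s| ^ 2 := by
  set R := RO γ.f γ.fd univ with hRdef
  rcases eq_or_ne s t with rfl | hst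
  · simp
  have hh : 0 < |t - s| := abs_pos.2 (sub_ne_zero.2 hst.symm)
  set d := γ.f t - γ.f s with hd
  set a := ⟪d, γ.fd s⟫ with ha
  set b := ⟪d, γ.fd t⟫ with hb
  have hdl : ‖d‖ ^ 2 ≤ |t - s| ^ 2 := pow_le_pow_left₀ (norm_nonneg _) (γ.norm_f_sub_le s t) 2
  have h1 : |a - (t - s)| ≤ K ^ 2 / 2 * |t - s| ^ 3 := γ.abs_inner_sub_le hK s t
  have h2 : |b - (t - s)| ≤ K ^ 2 / 2 * |t - s| ^ 3 := by
    have := γ.abs_inner_sub_le hK t s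
    have e : ⟪γ.f s - γ.f t, γ.fd t⟫ - (s - t) = -(b - (t - s)) := by
      rw [hb, hd, ← neg_sub (γ.f t), inner_neg_left]; ring
    rwa [e, abs_neg, abs_sub_comm s t] at this
  have h3 : 2 * R * ‖d - a • γ.fd s‖ ≤ ‖d‖ ^ 2 := γ.two_mul_RO_mul_norm_normal_le s t
  have h4 : 2 * R * ‖d - b • γ.fd t‖ ≤ ‖d‖ ^ 2 := by
    have := γ.two_mul_RO_mul_norm_normal_le t s
    rwa [← neg_sub (γ.f t), ← hd, inner_neg_left, ← hb, norm_neg, neg_smul, ← neg_sub',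
      norm_neg] at this
  have h3' : ‖d - a • γ.fd s‖ ≤ R⁻¹ / 2 * |t - s| ^ 2 := by
    have : R⁻¹ / 2 * |t - s| ^ 2 = |t - s| ^ 2 / (2 * R) := by field_simp
    rw [this, le_div_iff₀ (by positivity)]; linarith
  have h4' : ‖d - b • γ.fd t‖ ≤ R⁻¹ / 2 * |t - s| ^ 2 := by
    have : R⁻¹ / 2 * |t - s| ^ 2 = |t - s| ^ 2 / (2 * R) := by field_simp
    rw [this, le_div_iff₀ (by positivity)]; linarith
  have e : (t - s) • (γ.fd t - γ.fd s) = (a - (t - s)) • γ.fd s - (b - (t - s)) • γ.fd t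
      + (d - a • γ.fd s) - (d - b • γ.fd t) := by module
  have h5 : |t - s| * ‖γ.fd t - γ.fd s‖ ≤
      |t - s| * (R⁻¹ * |t - s| + K ^ 2 * |t - s| ^ 2) := by
    rw [← Real.norm_eq_abs (t - s), ← norm_smul, e, Real.norm_eq_abs]
    have n1 := norm_sub_le ((a - (t - s)) • γ.fd s - (b - (t - s)) • γ.fd t + (d - a • γ.fd s))
      (d - b • γ.fd t)
    have n2 := norm_add_le ((a - (t - s)) • γ.fd s - (b - (t - s)) • γ.fd t) (d - a • γ.fd s)
    have n3 := norm_sub_le ((a - (t - s)) • γ.fd s) ((b - (t - s)) • γ.fd t)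
    rw [norm_smul, norm_smul, γ.unit, γ.unit, Real.norm_eq_abs, Real.norm_eq_abs] at n3
    nlinarith
  exact le_of_mul_le_mul_left h5 hh

theorem curvAt_nonneg (s : ℝ) : 0 ≤ curvAt γ.fd univ s := Real.sInf_nonneg fun _ h => h.1

theorem curvAt_le {s Λ : ℝ} (hΛ : 0 ≤ Λ) (h : ∃ δ > 0, ∀ x y : ℝ, |x - s| < δ → |y - s| < δ →
    InnerProductGeometry.angle (γ.fd x) (γ.fd y) ≤ Λ * |x - y|) : curvAt γ.fd univ s ≤ Λ := by
  obtain ⟨δ, hδ, h⟩ := h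
  exact csInf_le ⟨0, fun _ h => h.1⟩ ⟨hΛ, δ, hδ, fun x _ y _ _ hx hy => h x y hx hy⟩

theorem angle_fd_le {K : NNReal} (hK : LipschitzWith K γ.fd) (x y : ℝ) :
    InnerProductGeometry.angle (γ.fd x) (γ.fd y) ≤ 5 * K * |x - y| := by
  have h1 := angle_le_norm_sub_add_cube (γ.unit x) (γ.unit y)
  have h2 := γ.norm_fd_sub_le hK y x
  have h3 : ‖γ.fd x - γ.fd y‖ ≤ 2 := by
    refine (norm_sub_le _ _).trans ?_
    rw [γ.unit, γ.unit]; norm_num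
  have h4 := norm_nonneg (γ.fd x - γ.fd y)
  have h5 : ‖γ.fd x - γ.fd y‖ ^ 2 ≤ 4 := by nlinarith
  nlinarith

theorem curvAt_set_nonempty (s : ℝ) : {Λ : ℝ | 0 ≤ Λ ∧ ∃ δ > 0, ∀ x ∈ (univ : Set ℝ),
    ∀ y ∈ (univ : Set ℝ), x ≠ y → |x - s| < δ → |y - s| < δ →
    InnerProductGeometry.angle (γ.fd x) (γ.fd y) ≤ Λ * |x - y|}.Nonempty := by
  obtain ⟨K, hK⟩ := γ.lipd
  exact ⟨5 * K, by positivity, 1, one_pos, fun x _ y _ _ _ _ => γ.angle_fd_le hK x y⟩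

theorem bddAbove_curvAt : BddAbove (range fun s => curvAt γ.fd univ s) := by
  obtain ⟨K, hK⟩ := γ.lipd
  refine ⟨5 * K, ?_⟩
  rintro _ ⟨s, rfl⟩
  exact γ.curvAt_le (by positivity) ⟨1, one_pos, fun x y _ _ => γ.angle_fd_le hK x y⟩

theorem supCurv_nonneg : 0 ≤ γ.supCurv := Real.iSup_nonneg γ.curvAt_nonneg

theorem lipschitz_supCurv : LipschitzWith γ.supCurv.toNNReal γ.fd := by
  have key : ∀ a b : ℝ, a ≤ b → ‖γ.fd b - γ.fd a‖ ≤ γ.supCurv * (b - a) := by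
    intro a b hab
    refine image_le_of_liminf_slope_right_le_deriv_boundary
      (f := fun x => ‖γ.fd x - γ.fd a‖) (a := a) (b := b) (B := fun x => γ.supCurv * (x - a))
      (B' := fun _ => γ.supCurv) ?_ (by simp) (by fun_prop) (fun x _ => ?_) (fun x _ r hr => ?_)
      (right_mem_Icc.2 hab)
    · have := γ.continuous_fd
      fun_prop
    · exact ((((hasDerivAt_id x).sub_const a).const_mul γ.supCurv).congr_deriv
        (by simp)).hasDerivWithinAt
    · have h1 : curvAt γ.fd univ x < r := (le_ciSup γ.bddAbove_curvAt x).trans_lt hr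
      obtain ⟨Λ, ⟨-, δ, hδ, hΛ⟩, hΛr⟩ := exists_lt_of_csInf_lt (γ.curvAt_set_nonempty x) h1
      refine Eventually.frequently ?_
      filter_upwards [Ioo_mem_nhdsGT (show x < x + δ by linarith)] with z hz
      have hzx : 0 < z - x := by linarith [hz.1]
      rw [slope_def_field, div_lt_iff₀ hzx]
      have h2 := hΛ z (mem_univ _) x (mem_univ _) hz.1.ne'
        (by rw [abs_of_pos hzx]; linarith [hz.2]) (by simpa using hδ)
      rw [abs_of_pos hzx] at h2
      have h3 := norm_sub_le_angle (γ.unit z) (γ.unit x)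
      have h4 := norm_sub_norm_le (γ.fd z - γ.fd a) (γ.fd x - γ.fd a)
      rw [sub_sub_sub_cancel_right] at h4
      nlinarith
  refine LipschitzWith.of_dist_le_mul fun x y => ?_
  rw [dist_eq_norm, Real.dist_eq, Real.coe_toNNReal _ γ.supCurv_nonneg]
  rcases le_total x y with h | h
  · rw [norm_sub_rev, abs_sub_comm, abs_of_nonneg (sub_nonneg.2 h)]
    exact key x y h
  · rw [abs_of_nonneg (sub_nonneg.2 h)]
    exact key y x h

theorem supCurv_pos : 0 < γ.supCurv := by
  refine γ.supCurv_nonneg.lt_of_ne fun h => ?_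
  have h1 := γ.norm_taylor_le γ.lipschitz_supCurv 0 (0 + γ.L)
  rw [γ.per, sub_self, zero_sub, norm_neg, norm_smul, γ.unit, ← h, add_sub_cancel_left,
    Real.norm_eq_abs, abs_of_pos γ.Lpos, Real.toNNReal_zero, NNReal.coe_zero] at h1
  linarith [γ.Lpos]

theorem mul_supCurv_lt_one {a : ℝ} (h : a < γ.Fk) : a * γ.supCurv.toNNReal < 1 := by
  rw [Real.coe_toNNReal _ γ.supCurv_nonneg]
  exact (lt_inv_mul_iff₀' γ.supCurv_pos).1 (by simpa [Fk] using h)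

theorem RO_le_Fk : RO γ.f γ.fd univ ≤ γ.Fk := by
  rcases γ.RO_nonneg.eq_or_lt with h | hR
  · rw [← h]; exact inv_nonneg.2 γ.supCurv_nonneg
  refine (le_inv_comm₀ hR γ.supCurv_pos).2
    (ciSup_le fun s => le_of_forall_pos_le_add fun ε hε => ?_)
  obtain ⟨K, hK⟩ := γ.lipd
  set c := (RO γ.f γ.fd univ)⁻¹ with hc
  have hc0 : 0 < c := inv_pos.2 hR
  refine γ.curvAt_le (by positivity) ?_
  have hcont : ContinuousAt (fun h : ℝ => c + K ^ 2 * h + K ^ 3 * h ^ 2) 0 := by fun_prop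
  obtain ⟨δ, hδ, hδε⟩ := Metric.eventually_nhds_iff.1
    (hcont.eventually_lt (g := fun _ => c + ε) continuousAt_const (by simpa using hε))
  refine ⟨δ / 2, by positivity, fun x y hx hy => ?_⟩
  have hxy : |x - y| < δ := by
    have := abs_sub_le x s y
    rw [abs_sub_comm s y] at this
    linarith
  have h1 := hδε (y := |x - y|) (by simpa using hxy)
  have h2 := angle_le_norm_sub_add_cube (γ.unit x) (γ.unit y)
  have h3 := γ.norm_fd_sub_le_of_RO_pos hK hR y x
  have h4 := pow_le_pow_left₀ (norm_nonneg _) (γ.norm_fd_sub_le hK y x) 3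
  rw [mul_pow] at h4
  have h5 := mul_le_mul_of_nonneg_left h1.le (abs_nonneg (x - y))
  rw [← hc] at h3
  nlinarith

end Knot

namespace Knot

variable {n : ℕ} (γ : Knot n)

theorem inner_eq_zero_of_isLocalExtr {p : Euc n} {x : ℝ}
    (h : IsLocalExtr (fun t => ‖γ.f t - p‖ ^ 2) x) : ⟪γ.f x - p, γ.fd x⟫ = 0 := by
  have h1 := h.hasDerivAt_eq_zero ((γ.deriv x).sub_const p).norm_sq
  linarith

theorem inner_eq_zero_of_isMinOn {p : Euc n} {x : ℝ} (h : ∀ t, ‖γ.f x - p‖ ≤ ‖γ.f t - p‖) :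
    ⟪γ.f x - p, γ.fd x⟫ = 0 :=
  γ.inner_eq_zero_of_isLocalExtr
    (.inl (.of_forall fun t => pow_le_pow_left₀ (norm_nonneg _) (h t) 2))

theorem inner_eq_zero_of_isMaxOn {p : Euc n} {x : ℝ} (h : ∀ t, ‖γ.f t - p‖ ≤ ‖γ.f x - p‖) :
    ⟪γ.f x - p, γ.fd x⟫ = 0 :=
  γ.inner_eq_zero_of_isLocalExtr
    (.inr (.of_forall fun t => pow_le_pow_left₀ (norm_nonneg _) (h t) 2))

theorem exists_mem_Ico (s a : ℝ) :
    ∃ m : ℤ, s + m • γ.L ∈ Ico a (a + γ.L) :=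
  (existsUnique_add_zsmul_mem_Ico γ.Lpos s a).exists

/-- The endpoints of a diameter form a double critical pair. -/
theorem exists_doubleCritical : ∃ x y : ℝ, γ.f x ≠ γ.f y ∧ ⟪γ.f x - γ.f y, γ.fd x⟫ = 0 ∧
    ⟪γ.f x - γ.f y, γ.fd y⟫ = 0 := by
  have hcf := γ.continuous_f
  have hne : (Icc 0 γ.L ×ˢ Icc 0 γ.L : Set (ℝ × ℝ)).Nonempty :=
    ⟨(0, 0), by simp [γ.Lpos.le]⟩
  obtain ⟨⟨x, y⟩, -, hmax⟩ := (isCompact_Icc.prod isCompact_Icc).exists_isMaxOn hne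
    (f := fun p : ℝ × ℝ => ‖γ.f p.1 - γ.f p.2‖) (by fun_prop)
  have hm : ∀ a b, ‖γ.f a - γ.f b‖ ≤ ‖γ.f x - γ.f y‖ := by
    intro a b
    obtain ⟨m, hm⟩ := γ.exists_mem_Ico a 0
    obtain ⟨k, hk⟩ := γ.exists_mem_Ico b 0
    rw [zero_add] at hm hk
    have := hmax (mk_mem_prod (Ico_subset_Icc_self hm) (Ico_subset_Icc_self hk))
    simpa only [mem_ofPred_eq, f_add_int] using this
  refine ⟨x, y, fun h => ?_, γ.inner_eq_zero_of_isMaxOn fun t => hm t y, ?_⟩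
  · have h1 := hm 0 (γ.L / 2)
    rw [h, sub_self, norm_zero, norm_le_zero_iff, sub_eq_zero] at h1
    have h2 := γ.eq_of_f_eq h1 (by
      rw [zero_sub, abs_neg, abs_of_pos (half_pos γ.Lpos)]; exact half_lt_self γ.Lpos)
    linarith [γ.Lpos]
  · rw [← neg_sub, inner_neg_left, neg_eq_zero]
    refine γ.inner_eq_zero_of_isMaxOn fun t => ?_
    rw [norm_sub_rev (γ.f y)]
    exact (norm_sub_rev _ _).trans_le (hm x t)

theorem RO_le_half_norm {x y : ℝ} (hxy : γ.f x ≠ γ.f y) (hx : ⟪γ.f x - γ.f y, γ.fd x⟫ = 0) :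
    RO γ.f γ.fd univ ≤ ‖γ.f x - γ.f y‖ / 2 := by
  have hd : 0 < ‖γ.f y - γ.f x‖ := norm_pos_iff.2 (sub_ne_zero.2 hxy.symm)
  have h := γ.two_mul_RO_mul_inner_le (s := x) y (w := ‖γ.f y - γ.f x‖⁻¹ • (γ.f y - γ.f x))
    (by rw [norm_smul, norm_inv, norm_norm, inv_mul_cancel₀ hd.ne'])
    (by rw [real_inner_smul_left, ← neg_sub, inner_neg_left, hx, neg_zero, mul_zero])
  rw [real_inner_smul_right, real_inner_self_eq_norm_sq, sq, inv_mul_cancel_left₀ hd.ne'] at h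
  rw [norm_sub_rev]
  nlinarith

theorem RO_le_half_MDC : RO γ.f γ.fd univ ≤ MDC γ.f γ.fd / 2 := by
  have h : 2 * RO γ.f γ.fd univ ≤ MDC γ.f γ.fd := by
    obtain ⟨x, y, h, hx, hy⟩ := γ.exists_doubleCritical
    refine le_csInf ⟨_, x, y, h, hx, hy, rfl⟩ ?_
    rintro _ ⟨x, y, h, hx, -, rfl⟩
    linarith [γ.RO_le_half_norm h hx]
  linarith

theorem MDC_le {x y : ℝ} (h : γ.f x ≠ γ.f y) (hx : ⟪γ.f x - γ.f y, γ.fd x⟫ = 0)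
    (hy : ⟪γ.f x - γ.f y, γ.fd y⟫ = 0) : MDC γ.f γ.fd ≤ ‖γ.f x - γ.f y‖ := by
  refine csInf_le ⟨0, ?_⟩ ⟨x, y, h, hx, hy, rfl⟩
  rintro _ ⟨x, y, -, -, -, rfl⟩
  exact norm_nonneg _

theorem RO_set_nonempty : {r : ℝ | 0 < r ∧ ∃ s ∈ (univ : Set ℝ), ∃ t ∈ (univ : Set ℝ), ∃ w : Euc n,
    ‖w‖ = 1 ∧ ⟪w, γ.fd s⟫ = 0 ∧ ‖γ.f t - γ.f s - r • w‖ < r}.Nonempty := by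
  obtain ⟨x, y, h, hx, -⟩ := γ.exists_doubleCritical
  have hd : 0 < ‖γ.f y - γ.f x‖ := norm_pos_iff.2 (sub_ne_zero.2 h.symm)
  refine ⟨‖γ.f y - γ.f x‖, hd, x, mem_univ _, y, mem_univ _,
    ‖γ.f y - γ.f x‖⁻¹ • (γ.f y - γ.f x), ?_, ?_, ?_⟩
  · rw [norm_smul, norm_inv, norm_norm, inv_mul_cancel₀ hd.ne']
  · rw [real_inner_smul_left, ← neg_sub, inner_neg_left, hx, neg_zero, mul_zero]
  · rwa [smul_inv_smul₀ hd.ne', sub_self, norm_zero]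

/-- Normal vectors shorter than the ball radius meet only trivially. -/
theorem eq_of_add_eq_add {s t : ℝ} {u w : Euc n} (hu : ⟪u, γ.fd s⟫ = 0) (hw : ⟪w, γ.fd t⟫ = 0)
    (hur : ‖u‖ < RO γ.f γ.fd univ) (hwr : ‖w‖ < RO γ.f γ.fd univ)
    (h : γ.f s + u = γ.f t + w) : γ.f s = γ.f t ∧ u = w := by
  suffices hst : γ.f s = γ.f t by
    refine ⟨hst, ?_⟩
    rw [hst] at h
    exact add_left_cancel h
  wlog huw : ‖u‖ ≤ ‖w‖ generalizing s t u w
  · exact (this hw hu hwr hur h.symm (le_of_not_ge huw)).symm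
  set R := RO γ.f γ.fd univ with hR
  rcases eq_or_ne w 0 with rfl | hw0
  · rw [norm_zero] at huw
    rw [norm_le_zero_iff.1 huw] at h
    simpa using h
  have hwp : 0 < ‖w‖ := norm_pos_iff.2 hw0
  have h1 := γ.two_mul_RO_mul_inner_le (s := t) s (w := ‖w‖⁻¹ • w)
    (by rw [norm_smul, norm_inv, norm_norm, inv_mul_cancel₀ hwp.ne'])
    (by rw [real_inner_smul_left, hw, mul_zero])
  have hd : γ.f s - γ.f t = w - u := by
    rw [sub_eq_sub_iff_add_eq_add, h, add_comm]
  have h2 : ‖u‖ ^ 2 = ‖γ.f s - γ.f t‖ ^ 2 - 2 * ⟪γ.f s - γ.f t, w⟫ + ‖w‖ ^ 2 := by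
    rw [← norm_sub_sq_real, hd, sub_sub_cancel_left, norm_neg]
  have h3 := pow_le_pow_left₀ (norm_nonneg _) huw 2
  rw [real_inner_smul_right, ← hR] at h1
  set I := ⟪γ.f s - γ.f t, w⟫
  have h4 : 2 * R * I ≤ ‖γ.f s - γ.f t‖ ^ 2 * ‖w‖ := by
    have e : 2 * R * I = 2 * R * (‖w‖⁻¹ * I) * ‖w‖ := by field_simp
    rw [e]
    exact mul_le_mul_of_nonneg_right h1 hwp.le
  have h5 : ‖γ.f s - γ.f t‖ ^ 2 * (R - ‖w‖) ≤ 0 := by nlinarith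
  have h6 : ‖γ.f s - γ.f t‖ ^ 2 ≤ 0 := by
    by_contra! hc
    nlinarith [mul_pos hc (sub_pos.2 hwr)]
  have h7 : ‖γ.f s - γ.f t‖ = 0 := by nlinarith [norm_nonneg (γ.f s - γ.f t)]
  exact sub_eq_zero.1 (norm_eq_zero.1 h7)

theorem exists_forall_norm_f_sub_le (c : Euc n) : ∃ x, ∀ t, ‖γ.f x - c‖ ≤ ‖γ.f t - c‖ := by
  have hcf := γ.continuous_f
  obtain ⟨x, -, hx⟩ := isCompact_Icc.exists_isMinOn (nonempty_Icc.2 γ.Lpos.le)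
    (f := fun x => ‖γ.f x - c‖) (by fun_prop)
  refine ⟨x, fun t => ?_⟩
  obtain ⟨m, hm⟩ := γ.exists_mem_Ico t 0
  rw [zero_add] at hm
  simpa only [mem_ofPred_eq, f_add_int] using hx (Ico_subset_Icc_self hm)

theorem le_RO_of_injective {r : ℝ} (h : ∀ s t : ℝ, ∀ u w : Euc n,
    ⟪u, γ.fd s⟫ = 0 → ⟪w, γ.fd t⟫ = 0 → ‖u‖ < r → ‖w‖ < r →
    γ.f s + u = γ.f t + w → γ.f s = γ.f t ∧ u = w) : r ≤ RO γ.f γ.fd univ := by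
  refine le_csInf γ.RO_set_nonempty ?_
  rintro ρ ⟨hρ, s, -, t, -, w, hw, hws, hlt⟩
  by_contra! hρr
  obtain ⟨x, hx⟩ := γ.exists_forall_norm_f_sub_le (γ.f s + ρ • w)
  have hxρ : ‖γ.f s + ρ • w - γ.f x‖ < ρ := by
    rw [norm_sub_rev]
    exact (hx t).trans_lt (by rwa [← sub_sub])
  have hn : ‖ρ • w‖ = ρ := by rw [norm_smul, hw, mul_one, Real.norm_eq_abs, abs_of_pos hρ]
  obtain ⟨-, he⟩ := h s x (ρ • w) (γ.f s + ρ • w - γ.f x)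
    (by rw [real_inner_smul_left, hws, mul_zero])
    (by rw [← neg_sub, inner_neg_left, γ.inner_eq_zero_of_isMinOn hx, neg_zero])
    (hn.trans_lt hρr) (hxρ.trans hρr) (by abel)
  rw [← he, hn] at hxρ
  exact lt_irrefl _ hxρ

theorem injRad_eq_RO : injRad γ.f γ.fd = RO γ.f γ.fd univ := by
  have hub : RO γ.f γ.fd univ ∈ upperBounds ({0} ∪ {r : ℝ | 0 < r ∧ ∀ s t : ℝ, ∀ u w : Euc n,
      ⟪u, γ.fd s⟫ = 0 → ⟪w, γ.fd t⟫ = 0 → ‖u‖ < r → ‖w‖ < r →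
      γ.f s + u = γ.f t + w → γ.f s = γ.f t ∧ u = w}) := by
    rintro r (rfl | ⟨-, h⟩)
    · exact γ.RO_nonneg
    · exact γ.le_RO_of_injective h
  refine (IsGreatest.csSup_eq ⟨?_, hub⟩)
  rcases γ.RO_nonneg.eq_or_lt with h | h
  · exact .inl h.symm
  · exact .inr ⟨h, fun s t u w hu hw hur hwr => γ.eq_of_add_eq_add hu hw hur hwr⟩

/-- If the ball radius is below the focal distance, it is realized by a closed ball tangent to the
curve at one point and touching it at another. -/
theorem exists_touching_ball (h : RO γ.f γ.fd univ < γ.Fk) : ∃ s t : ℝ, ∃ u : Euc n,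
    γ.f s ≠ γ.f t ∧ ⟪u, γ.fd s⟫ = 0 ∧ ‖u‖ = RO γ.f γ.fd univ ∧
    ‖γ.f t - γ.f s - u‖ = RO γ.f γ.fd univ := by
  obtain ⟨ρ, hRρ, hρF⟩ := exists_between h
  have hρ0 : 0 ≤ ρ := γ.RO_nonneg.trans hRρ.le
  obtain ⟨δ, hδ, m, hm, hgrow⟩ := γ.exists_quadratic_growth γ.lipschitz_supCurv hρ0
    (γ.mul_supCurv_lt_one hρF)
  have hcf := γ.continuous_f
  have hcd := γ.continuous_fd
  set S : Set (ℝ × ℝ × ℝ × Euc n) := (Icc 0 ρ ×ˢ Icc 0 γ.L ×ˢ Icc (-γ.L) (2 * γ.L) ×ˢ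
      Metric.closedBall 0 1) ∩ {q | ‖q.2.2.2‖ = 1 ∧ ⟪q.2.2.2, γ.fd q.2.1⟫ = 0 ∧
      ‖γ.f q.2.2.1 - γ.f q.2.1 - q.1 • q.2.2.2‖ ≤ q.1 ∧
      δ ≤ |q.2.2.1 - q.2.1| ∧ |q.2.2.1 - q.2.1| ≤ γ.L / 2} with hS
  have hScomp : IsCompact S := by
    refine (isCompact_Icc.prod (isCompact_Icc.prod (isCompact_Icc.prod
      (isCompact_closedBall _ _)))).inter_right ?_
    simp only [ofPred_and]
    refine (isClosed_eq ?_ ?_).inter ((isClosed_eq ?_ ?_).inter ((isClosed_le ?_ ?_).inter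
      ((isClosed_le ?_ ?_).inter (isClosed_le ?_ ?_)))) <;> fun_prop
  have hBS : ∀ r ≤ ρ, 0 < r → ∀ s t : ℝ, ∀ w : Euc n, ‖w‖ = 1 → ⟪w, γ.fd s⟫ = 0 →
      ‖γ.f t - γ.f s - r • w‖ < r → ∃ s' t' : ℝ, (r, s', t', w) ∈ S := by
    intro r hrρ hr s t w hw hws hlt
    obtain ⟨k, hk⟩ := γ.exists_mem_Ico s 0
    obtain ⟨l, hl⟩ := γ.exists_mem_Ico t (s + k • γ.L - γ.L / 2)
    rw [zero_add] at hk
    have h1 : |t + l • γ.L - (s + k • γ.L)| ≤ γ.L / 2 :=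
      abs_le.2 ⟨by linarith [hl.1], by linarith [hl.2]⟩
    rw [← γ.f_add_int s k, ← γ.f_add_int t l] at hlt
    rw [← γ.fd_add_int s k] at hws
    have hn : ‖r • w‖ = r := by rw [norm_smul, hw, mul_one, Real.norm_eq_abs, abs_of_pos hr]
    refine ⟨_, _, ⟨⟨⟨hr.le, hrρ⟩, Ico_subset_Icc_self hk,
      ⟨by linarith [hl.1, hk.1, γ.Lpos], by linarith [hl.2, hk.2, γ.Lpos]⟩, by simp [hw]⟩,
      hw, hws, hlt.le, ?_, h1⟩⟩
    by_contra! hc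
    have h2 := hgrow _ _ hc.le (r • w) (by rw [real_inner_smul_left, hws, mul_zero])
      (hn.trans_le hrρ)
    have h3 := pow_lt_pow_left₀ hlt (norm_nonneg _) two_ne_zero
    rw [hn] at h2
    nlinarith [mul_nonneg hm.le (sq_nonneg (t + l • γ.L - (s + k • γ.L)))]
  obtain ⟨r₁, ⟨hr₁, s₁, -, t₁, -, w₁, hw₁, hws₁, hlt₁⟩, hr₁ρ⟩ :=
    exists_lt_of_csInf_lt γ.RO_set_nonempty hRρ
  obtain ⟨s₁', t₁', hmem₁⟩ := hBS r₁ hr₁ρ.le hr₁ s₁ t₁ w₁ hw₁ hws₁ hlt₁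
  obtain ⟨⟨r, s, t, w⟩, hq, hmin⟩ := hScomp.exists_isMinOn ⟨_, hmem₁⟩ (f := fun q => q.1)
    (by fun_prop)
  obtain ⟨⟨⟨hr0, hrρ⟩, -⟩, hw, hws, hle, hδst, hst⟩ := hq
  simp only at hr0 hrρ hw hws hle hδst hst
  have hne : γ.f s ≠ γ.f t := by
    intro he
    have := γ.eq_of_f_eq he.symm (by linarith [γ.Lpos])
    rw [this, sub_self, abs_zero] at hδst
    linarith
  have hrR : r ≤ RO γ.f γ.fd univ := by
    refine le_csInf γ.RO_set_nonempty ?_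
    rintro r₂ ⟨hr₂, s₂, -, t₂, -, w₂, hw₂, hws₂, hlt₂⟩
    rcases le_or_gt r₂ ρ with h2 | h2
    · obtain ⟨s', t', hmem⟩ := hBS r₂ h2 hr₂ s₂ t₂ w₂ hw₂ hws₂ hlt₂
      exact hmin hmem
    · exact hrρ.trans h2.le
  have hrn : ‖r • w‖ = r := by
    rw [norm_smul, hw, mul_one, Real.norm_eq_abs, abs_of_nonneg hr0]
  have hRr : RO γ.f γ.fd univ ≤ r := by
    refine le_of_forall_gt_imp_ge_of_dense fun r' hr' => ?_
    refine γ.RO_le (hr0.trans_lt hr') hw hws (t := t)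
      ((norm_sub_smul_lt_iff (hr0.trans_lt hr') hw).2 ?_)
    have hd : 0 < ‖γ.f t - γ.f s‖ := norm_pos_iff.2 (sub_ne_zero.2 hne.symm)
    have h1 := pow_le_pow_left₀ (norm_nonneg _) hle 2
    rw [norm_sub_sq_real, hrn, real_inner_smul_right] at h1
    have h2 : 0 < ⟪γ.f t - γ.f s, w⟫ := by
      by_contra! hc
      nlinarith [pow_pos hd 2, mul_nonneg hr0 (neg_nonneg.2 hc)]
    nlinarith
  have hRr' := le_antisymm hRr hrR
  refine ⟨s, t, r • w, hne, by rw [real_inner_smul_left, hws, mul_zero], by rw [hrn, hRr'], ?_⟩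
  refine le_antisymm (by rw [hRr']; exact hle) ?_
  have := γ.RO_le_norm_sub t hw hws
  rwa [hRr'] at this ⊢

/-- Normal disks of radius below the focal distance stay surjective near an interior point under
perturbation: nearby points that are closer to `f s` are reached by shorter normals near `s`. -/
theorem eventually_exists_normal {s : ℝ} {u : Euc n} (hu : ⟪u, γ.fd s⟫ = 0) (huF : ‖u‖ < γ.Fk)
    {ε : ℝ} (hε : 0 < ε) : ∀ᶠ c in 𝓝 (γ.f s + u), ‖γ.f s - c‖ < ‖u‖ →
      ∃ x, ‖γ.f x - γ.f s‖ ≤ ε ∧ ⟪c - γ.f x, γ.fd x⟫ = 0 ∧ ‖c - γ.f x‖ < ‖u‖ := by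
  have hcf := γ.continuous_f
  obtain ⟨δ, hδ, m, hm, hgrow⟩ := γ.exists_quadratic_growth γ.lipschitz_supCurv (norm_nonneg u)
    (γ.mul_supCurv_lt_one huF)
  set η := min δ ε with hη
  have hη0 : 0 < η := lt_min hδ hε
  have hend : ∀ t, |t - s| = η → ∀ᶠ c in 𝓝 (γ.f s + u), ‖u‖ < ‖γ.f t - c‖ := by
    intro t ht
    have h1 := hgrow s t (ht.trans_le (min_le_left _ _)) u hu le_rfl
    have h2 : ‖u‖ < ‖γ.f t - (γ.f s + u)‖ := by
      rw [← sub_sub]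
      refine lt_of_pow_lt_pow_left₀ 2 (norm_nonneg _) ?_
      have : 0 < (t - s) ^ 2 := by rw [← sq_abs, ht]; positivity
      nlinarith [mul_pos hm this]
    have h3 : Continuous fun c => ‖γ.f t - c‖ := by fun_prop
    exact h3.continuousAt.eventually_const_lt h2
  filter_upwards [hend (s + η) (by simp [hη0.le]), hend (s - η) (by simp [hη0.le])]
    with c hc1 hc2 hsc
  obtain ⟨x, hx, hmin⟩ := isCompact_Icc.exists_isMinOn
    (nonempty_Icc.2 (show s - η ≤ s + η by linarith))
    (f := fun x => ‖γ.f x - c‖) (by fun_prop)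
  have hxs : ‖γ.f x - c‖ ≤ ‖γ.f s - c‖ := hmin ⟨by linarith, by linarith⟩
  have hx1 : x ≠ s + η := by rintro rfl; linarith
  have hx2 : x ≠ s - η := by rintro rfl; linarith
  have hxI : Icc (s - η) (s + η) ∈ 𝓝 x :=
    Icc_mem_nhds (lt_of_le_of_ne hx.1 hx2.symm) (lt_of_le_of_ne hx.2 hx1)
  refine ⟨x, ?_, ?_, ?_⟩
  · refine (γ.norm_f_sub_le s x).trans ((abs_le.2 ⟨?_, ?_⟩).trans (min_le_right δ ε)) <;>
      linarith [hx.1, hx.2]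
  · rw [← neg_sub, inner_neg_left, neg_eq_zero]
    refine γ.inner_eq_zero_of_isLocalExtr (.inl ?_)
    filter_upwards [hxI] with t ht
    exact pow_le_pow_left₀ (norm_nonneg _) (hmin ht) 2
  · rw [norm_sub_rev]; linarith

theorem half_MDC_le_RO_of_lt_Fk (h : RO γ.f γ.fd univ < γ.Fk) :
    MDC γ.f γ.fd / 2 ≤ RO γ.f γ.fd univ := by
  obtain ⟨s, t, u, hne, hus, hu, htR⟩ := γ.exists_touching_ball h
  set R := RO γ.f γ.fd univ with hR
  have hd : 0 < ‖γ.f s - γ.f t‖ := norm_pos_iff.2 (sub_ne_zero.2 hne)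
  have hR0 : 0 < R := by
    refine γ.RO_nonneg.lt_of_ne fun h0 => hd.ne' ?_
    rw [← hR] at h0
    rw [← h0, norm_eq_zero] at hu htR
    rw [hu, sub_zero] at htR
    rw [norm_sub_rev, htR, norm_zero]
  set v := γ.f s + u - γ.f t with hv
  have hvn : ‖v‖ = R := by rw [hv, norm_sub_rev, ← htR, sub_sub]
  have hvt : ⟪v, γ.fd t⟫ = 0 := by
    have hw : ‖R⁻¹ • u‖ = 1 := by
      rw [norm_smul, hu, norm_inv, Real.norm_eq_abs, abs_of_pos hR0, inv_mul_cancel₀ hR0.ne']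
    have h1 := γ.inner_eq_zero_of_isMinOn (p := γ.f s + u) (x := t) fun x => by
      have := γ.RO_le_norm_sub (s := s) x hw (by rw [real_inner_smul_left, hus, mul_zero])
      rw [← hR, smul_inv_smul₀ hR0.ne'] at this
      rwa [← sub_sub, ← sub_sub, htR]
    rw [hv, ← neg_sub, inner_neg_left, h1, neg_zero]
  have hdvu : γ.f s - γ.f t = v - u := by rw [hv]; abel
  rcases eq_or_ne (u + v) 0 with hz | hz
  · have hvu : v = -u := eq_neg_of_add_eq_zero_right hz
    have h1 : MDC γ.f γ.fd ≤ ‖γ.f s - γ.f t‖ := by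
      refine γ.MDC_le hne ?_ ?_
      · rw [hdvu, hvu, inner_sub_left, inner_neg_left, hus]; simp
      · rw [hdvu, eq_neg_of_add_eq_zero_left hz, inner_sub_left, inner_neg_left, hvt]; simp
    have h2 : ‖γ.f s - γ.f t‖ ≤ R + R := by
      rw [hdvu]
      exact (norm_sub_le _ _).trans_eq (by rw [hvn, hu])
    linarith
  exfalso
  have hpath : Tendsto (fun ε : ℝ => γ.f s + u - ε • (u + v)) (𝓝[>] 0) (𝓝 (γ.f s + u)) := by
    have : Continuous fun ε : ℝ => γ.f s + u - ε • (u + v) := by fun_prop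
    simpa using (this.tendsto 0).mono_left nhdsWithin_le_nhds
  have hpath' : Tendsto (fun ε : ℝ => γ.f s + u - ε • (u + v)) (𝓝[>] 0) (𝓝 (γ.f t + v)) := by
    have : γ.f t + v = γ.f s + u := by rw [hv]; abel
    rwa [this]
  have hshort : ∀ a b : Euc n, ‖a‖ = R → ‖b‖ = R → a + b ≠ 0 → ∀ ε : ℝ, 0 < ε → ε < 1 →
      ‖a - ε • (a + b)‖ < R := by
    intro a b ha hb hab ε h0 h1
    refine lt_of_pow_lt_pow_left₀ 2 hR0.le ?_
    have h2 : 0 < ‖a + b‖ ^ 2 := pow_pos (norm_pos_iff.2 hab) 2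
    have h3 : ⟪a, a + b⟫ = ‖a + b‖ ^ 2 / 2 := by
      rw [norm_add_sq_real, inner_add_right, real_inner_self_eq_norm_sq, ha, hb]; ring
    rw [norm_sub_sq_real, real_inner_smul_right, h3, norm_smul, mul_pow, Real.norm_eq_abs, sq_abs,
      ha]
    nlinarith [mul_pos (mul_pos h0 (sub_pos.2 h1)) h2]
  obtain ⟨ε, ⟨hε0, hε1⟩, hs, ht⟩ := ((eventually_mem_set.2 (Ioo_mem_nhdsGT (zero_lt_one' ℝ))).and
    ((hpath.eventually (γ.eventually_exists_normal hus (hu.trans_lt h)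
      (show 0 < ‖γ.f s - γ.f t‖ / 3 by positivity))).and
    (hpath'.eventually (γ.eventually_exists_normal hvt (hvn.trans_lt h)
      (show 0 < ‖γ.f s - γ.f t‖ / 3 by positivity))))).exists
  obtain ⟨x, hxs, hxn, hxR⟩ := hs (by
    have e : γ.f s + u - ε • (u + v) - γ.f s = u - ε • (u + v) := by abel
    rw [hu, norm_sub_rev, e]
    exact hshort u v hu hvn hz ε hε0 hε1)
  obtain ⟨y, hyt, hyn, hyR⟩ := ht (by
    have e : γ.f s + u - ε • (u + v) - γ.f t = v - ε • (v + u) := by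
      rw [add_comm v u, hv]; abel
    rw [hvn, norm_sub_rev, e]
    exact hshort v u hvn hu (by rwa [add_comm]) ε hε0 hε1)
  rw [hu] at hxR
  rw [hvn] at hyR
  obtain ⟨hxy, -⟩ := γ.eq_of_add_eq_add hxn hyn hxR hyR (by abel)
  have h1 : ‖γ.f s - γ.f t‖ ≤ ‖γ.f x - γ.f s‖ + ‖γ.f y - γ.f t‖ := by
    rw [← hxy, norm_sub_rev (γ.f x) (γ.f s)]
    exact norm_sub_le_norm_sub_add_norm_sub _ _ _
  linarith

theorem RO_eq_min : RO γ.f γ.fd univ = min γ.Fk (MDC γ.f γ.fd / 2) := by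
  refine le_antisymm (le_min γ.RO_le_Fk γ.RO_le_half_MDC) ?_
  rcases lt_or_ge (RO γ.f γ.fd univ) γ.Fk with h | h
  · exact (min_le_right _ _).trans (γ.half_MDC_le_RO_of_lt_Fk h)
  · exact (min_le_left _ _).trans h

end Knot

/-- Thickness Formula. For every knot `γ` in `ℝⁿ` with image `K`,
`i(K,ℝⁿ) = R_O(K) = min {F_k(γ), MDC(K)/2}`. -/
theorem statement_5 {n : ℕ} (hn : 2 ≤ n) (γ : Knot n) :
    injRad γ.f γ.fd = RO γ.f γ.fd Set.univ ∧
    RO γ.f γ.fd Set.univ = min γ.Fk (MDC γ.f γ.fd / 2) := by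
  exact ⟨γ.injRad_eq_RO, γ.RO_eq_min⟩
end

section
/- Let γ : [0,L] → ℝⁿ (n ≥ 2) be a unit-speed curve of minimal length in C(p,q;v,w;Λ). Then for every s ∈ [0,L], either κγ(s) = 0 or κγ(s) = Λ. Moreover, the set {s ∈ [0,L] : κγ(s) = Λ} is closed in [0,L], and every s with κγ(s) < Λ has a relatively open neighborhood J in [0,L] on which γ' is constant (γ is a line segment on J). -/
open Set Filter MeasureTheory
open scoped RealInnerProductSpace Topology ENNReal

open InnerProductGeometry in
theorem norm_sub_eq_two_mul_sin_half_angle_s13 {E : Type*} [NormedAddCommGroup E]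
    [InnerProductSpace ℝ E] {u v : E} (hu : ‖u‖ = 1) (hv : ‖v‖ = 1) :
    ‖u - v‖ = 2 * Real.sin (angle u v / 2) := by
  have h0 := angle_nonneg u v
  have hpi := angle_le_pi u v
  have hs : 0 ≤ Real.sin (angle u v / 2) :=
    Real.sin_nonneg_of_nonneg_of_le_pi (by linarith) (by linarith [Real.pi_pos])
  have hcos : Real.cos (angle u v) = ⟪u, v⟫ := by rw [cos_angle, hu, hv]; simp
  have h1 : ‖u - v‖ ^ 2 = (2 * Real.sin (angle u v / 2)) ^ 2 := by
    rw [norm_sub_sq_real, hu, hv, ← hcos]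
    have h2 := Real.cos_sq (angle u v / 2)
    have h3 := Real.sin_sq_add_cos_sq (angle u v / 2)
    rw [mul_div_cancel₀ _ two_ne_zero] at h2
    linarith
  exact (pow_left_inj₀ (norm_nonneg _) (by positivity) two_ne_zero).1 h1

open InnerProductGeometry in
theorem norm_sub_le_angle_s13 {E : Type*} [NormedAddCommGroup E]
    [InnerProductSpace ℝ E] {u v : E} (hu : ‖u‖ = 1) (hv : ‖v‖ = 1) :
    ‖u - v‖ ≤ angle u v := by
  rw [norm_sub_eq_two_mul_sin_half_angle_s13 hu hv]
  have := Real.sin_le (x := angle u v / 2) (by linarith [angle_nonneg u v])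
  linarith

open InnerProductGeometry in
theorem angle_mul_one_sub_half_norm_sub_le {E : Type*} [NormedAddCommGroup E]
    [InnerProductSpace ℝ E] {u v : E} (hu : ‖u‖ = 1) (hv : ‖v‖ = 1) :
    angle u v * (1 - ‖u - v‖ / 2) ≤ ‖u - v‖ := by
  rw [norm_sub_eq_two_mul_sin_half_angle_s13 hu hv]
  have h0 := angle_nonneg u v
  have hpi := angle_le_pi u v
  set x := angle u v / 2 with hx
  have hθ : angle u v = 2 * x := by rw [hx]; ring
  have hs : 0 ≤ Real.sin x :=
    Real.sin_nonneg_of_nonneg_of_le_pi (by linarith) (by linarith [Real.pi_pos])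
  have hc : 0 ≤ Real.cos x := Real.cos_nonneg_of_mem_Icc ⟨by linarith, by linarith⟩
  have hsum : 1 - Real.sin x ≤ Real.cos x := by
    nlinarith [Real.sin_sq_add_cos_sq x, Real.sin_le_one x, Real.cos_le_one x]
  have hxc : x * Real.cos x ≤ Real.sin x := by
    rcases hc.eq_or_lt with hc0 | hc0
    · rw [← hc0]; simpa using hs
    · have hlt : x < Real.pi / 2 := by
        refine lt_of_le_of_ne (by linarith) fun h => ?_
        rw [h, Real.cos_pi_div_two] at hc0
        exact lt_irrefl _ hc0
      have := Real.le_tan (by linarith) hlt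
      rwa [Real.tan_eq_sin_div_cos, le_div_iff₀ hc0] at this
  rw [hθ]
  have hx0 : 0 ≤ x := by linarith
  nlinarith [mul_le_mul_of_nonneg_left hsum hx0]

/-- Normalizing vectors of norm at least `m` contracts distances up to the factor `m⁻¹`. -/
theorem mul_norm_normalize_sub_le {E : Type*} [NormedAddCommGroup E]
    [InnerProductSpace ℝ E] {x y : E} {m : ℝ} (hm : 0 < m) (hx : m ≤ ‖x‖) (hy : m ≤ ‖y‖) :
    m * ‖‖x‖⁻¹ • x - ‖y‖⁻¹ • y‖ ≤ ‖x - y‖ := by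
  have hx0 : 0 < ‖x‖ := hm.trans_le hx
  have hy0 : 0 < ‖y‖ := hm.trans_le hy
  refine le_of_sq_le_sq ?_ (norm_nonneg _)
  have h1 : ‖‖x‖⁻¹ • x - ‖y‖⁻¹ • y‖ ^ 2 = 2 - 2 * (‖x‖⁻¹ * ‖y‖⁻¹ * ⟪x, y⟫) := by
    rw [norm_sub_sq_real, norm_smul, norm_smul, real_inner_smul_left, real_inner_smul_right]
    simp only [norm_inv, norm_norm, inv_mul_cancel₀ hx0.ne', inv_mul_cancel₀ hy0.ne']
    ring
  have h2 : ‖x‖ * ‖y‖ * ‖‖x‖⁻¹ • x - ‖y‖⁻¹ • y‖ ^ 2 = 2 * ‖x‖ * ‖y‖ - 2 * ⟪x, y⟫ := by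
    rw [h1]; field_simp
  have h3 : m * m ≤ ‖x‖ * ‖y‖ := mul_le_mul hx hy hm.le hx0.le
  have h4 := mul_le_mul_of_nonneg_right h3 (sq_nonneg ‖‖x‖⁻¹ • x - ‖y‖⁻¹ • y‖)
  rw [norm_sub_sq_real]
  nlinarith [sq_nonneg (‖x‖ - ‖y‖)]

/-- A regular `C¹` curve with velocity `V` and the right boundary data, whose direction field is
`Λ`-Lipschitz with respect to arclength, can be reparametrized to an element of
`C(p, q; v, w; Λ)`. -/
theorem exists_curveCC_of_velocity {n : ℕ} {p q v w : Euc n} {Λ : ℝ} (hΛ : 0 ≤ Λ)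
    {L m : ℝ} (hL : 0 ≤ L) (hm : 0 < m) {V : ℝ → Euc n} (hV : Continuous V)
    (hVm : ∀ t, m ≤ ‖V t‖) (hV0 : V 0 = v) (hVL : V L = w) (hv : ‖v‖ = 1) (hw : ‖w‖ = 1)
    (hq : p + ∫ t in (0 : ℝ)..L, V t = q)
    (hlip : ∀ x y, 0 ≤ x → x ≤ y → y ≤ L →
      ‖‖V x‖⁻¹ • V x - ‖V y‖⁻¹ • V y‖ ≤ Λ * ∫ t in x..y, ‖V t‖) :
    ∃ η : CurveCC n p q v w Λ, η.L = ∫ t in (0 : ℝ)..L, ‖V t‖ := by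
  have hVpos : ∀ t, 0 < ‖V t‖ := fun t => hm.trans_le (hVm t)
  set σ : ℝ → ℝ := fun x => ∫ t in (0 : ℝ)..x, ‖V t‖ with hσ
  have hσd : ∀ x, HasDerivAt σ ‖V x‖ x := fun x => (hV.norm).integral_hasStrictDerivAt 0 x |>.hasDerivAt
  have hσsub : ∀ x y, ∫ t in x..y, ‖V t‖ = σ y - σ x := fun x y =>
    (intervalIntegral.integral_interval_sub_left (μ := volume) (hV.norm.intervalIntegrable _ _)
      (hV.norm.intervalIntegrable _ _)).symm
  have hσc : Continuous σ := continuous_iff_continuousAt.2 fun x => (hσd x).continuousAt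
  have hσm : StrictMono σ := strictMono_of_hasDerivAt_pos hσd fun x => hVpos x
  have hgrow : ∀ x y, x ≤ y → m * (y - x) ≤ σ y - σ x := by
    intro x y hxy
    rw [← hσsub]
    have := intervalIntegral.integral_mono_on hxy (intervalIntegrable_const (μ := volume) (c := m))
      (hV.norm.intervalIntegrable x y) (fun t _ => hVm t)
    simpa [mul_comm] using this
  have hσ0 : σ 0 = 0 := by simp [hσ]
  have hsurj : Function.Surjective σ := by
    refine hσc.surjective ?_ ?_
    · refine tendsto_atTop_mono' atTop ?_ (tendsto_id.const_mul_atTop hm)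
      filter_upwards [eventually_ge_atTop 0] with x hx
      simpa [hσ0] using hgrow 0 x hx
    · refine tendsto_atBot_mono' atBot ?_ (tendsto_id.const_mul_atBot hm)
      filter_upwards [eventually_le_atBot 0] with x hx
      have := hgrow x 0 hx
      simp only [hσ0, id] at this ⊢
      linarith
  set e := hσm.orderIsoOfSurjective σ hsurj with he
  set τ : ℝ → ℝ := fun x => e.symm x with hτ
  have hτσ : ∀ x, τ (σ x) = x := fun x => e.symm_apply_apply x
  have hστ : ∀ x, σ (τ x) = x := fun x => e.apply_symm_apply x
  have hτm : Monotone τ := e.symm.monotone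
  have hτc : Continuous τ := e.symm.continuous
  have hτd : ∀ x, HasDerivAt τ ‖V (τ x)‖⁻¹ x := fun x =>
    HasDerivAt.of_local_left_inverse hτc.continuousAt (hσd _) (hVpos _).ne'
      (Eventually.of_forall hστ)
  have hτ0 : τ 0 = 0 := by simpa [hσ0] using hτσ 0
  have hmem : ∀ s ∈ Icc 0 (σ L), τ s ∈ Icc 0 L := fun s hs =>
    ⟨hτ0 ▸ hτm hs.1, hτσ L ▸ hτm hs.2⟩
  have hFd : ∀ x, HasDerivAt (fun x => p + ∫ t in (0 : ℝ)..x, V t) (V x) x := fun x =>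
    (hV.integral_hasStrictDerivAt 0 x).hasDerivAt.const_add p
  have key : ∀ x ∈ Icc 0 (σ L), ∀ y ∈ Icc 0 (σ L), x ≤ y →
      ‖‖V (τ x)‖⁻¹ • V (τ x) - ‖V (τ y)‖⁻¹ • V (τ y)‖ ≤ Λ * |x - y| := by
    intro x hx y hy hxy
    have := hlip (τ x) (τ y) (hmem x hx).1 (hτm hxy) (hmem y hy).2
    rwa [hσsub, hστ, hστ, ← abs_of_nonneg (sub_nonneg.2 hxy), abs_sub_comm] at this
  refine ⟨{
    L := σ L
    Lnn := hσ0 ▸ hσm.monotone hL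
    f := fun s => p + ∫ t in (0 : ℝ)..τ s, V t
    fd := fun s => ‖V (τ s)‖⁻¹ • V (τ s)
    deriv := fun s _ => ((hFd (τ s)).scomp s (hτd s)).hasDerivWithinAt
    unit := fun s _ => by
      rw [norm_smul, norm_inv, norm_norm, inv_mul_cancel₀ (hVpos _).ne']
    lip := by
      refine LipschitzOnWith.of_dist_le_mul fun x hx y hy => ?_
      rw [dist_eq_norm, Real.dist_eq, Real.coe_toNNReal _ hΛ]
      rcases le_total x y with h | h
      · exact key x hx y hy h
      · rw [norm_sub_rev, abs_sub_comm]
        exact key y hy x hx h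
    i0 := by simp [hτ0]
    id0 := by simp [hτ0, hV0, hv]
    iL := by simp only [hτσ, hq]
    idL := by simp [hτσ, hVL, hw] }, rfl⟩

/-- A bound by an additive interval function extends from two adjacent intervals to their union. -/
theorem norm_sub_le_of_adjacent {E : Type*} [NormedAddCommGroup E] {U : ℝ → E} {σ : ℝ → ℝ}
    {a b c : ℝ}
    (h₁ : ∀ x y, a ≤ x → x ≤ y → y ≤ b → ‖U x - U y‖ ≤ σ y - σ x)
    (h₂ : ∀ x y, b ≤ x → x ≤ y → y ≤ c → ‖U x - U y‖ ≤ σ y - σ x) :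
    ∀ x y, a ≤ x → x ≤ y → y ≤ c → ‖U x - U y‖ ≤ σ y - σ x := by
  intro x y hx hxy hy
  rcases le_total y b with hyb | hyb
  · exact h₁ x y hx hxy hyb
  rcases le_total b x with hbx | hbx
  · exact h₂ x y hbx hxy hy
  have := norm_sub_le_norm_sub_add_norm_sub (U x) (U b) (U y)
  linarith [h₁ x b hx hbx le_rfl, h₂ b y le_rfl hyb hy]

/-- If the tangent field of a unit-speed curve has Lipschitz constant less than `Λ` on
`[a, b]` and is not constant there, then the curve is not a length-minimizer. -/
theorem CurveCC.exists_shorter {n : ℕ} {p q v w : Euc n} (hv : ‖v‖ = 1) (hw : ‖w‖ = 1)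
    {Λ Λ' : ℝ} (hΛ : 0 < Λ) (hΛ' : Λ' < Λ) (γ : CurveCC n p q v w Λ) {m r : ℝ} (hr : 0 < r)
    (h0 : 0 ≤ m - r) (hL : m + r ≤ γ.L)
    (hlip : ∀ x ∈ Icc (m - r) (m + r), ∀ y ∈ Icc (m - r) (m + r),
      ‖γ.fd x - γ.fd y‖ ≤ Λ' * |x - y|)
    {x₀ y₀ : ℝ} (hx₀ : x₀ ∈ Ioo (m - r) (m + r)) (hy₀ : y₀ ∈ Ioo (m - r) (m + r))
    (hne : γ.fd x₀ ≠ γ.fd y₀) :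
    ∃ η : CurveCC n p q v w Λ, η.L < γ.L := by
  have hL0 := γ.Lnn
  obtain ⟨T, hTc, hT⟩ : ∃ T : ℝ → Euc n, Continuous T ∧
      ∀ t, ∃ s ∈ Icc 0 γ.L, T t = γ.fd s ∧ (t ∈ Icc 0 γ.L → s = t) := by
    refine ⟨IccExtend hL0 ((Icc 0 γ.L).domRestrict γ.fd),
      (γ.lip.continuousOn.domRestrict).Icc_extend', fun t =>
      ⟨projIcc 0 γ.L hL0 t, (projIcc 0 γ.L hL0 t).2, rfl, fun ht => ?_⟩⟩
    rw [projIcc_of_mem hL0 ht]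
  have hTeq : ∀ t ∈ Icc 0 γ.L, T t = γ.fd t := fun t ht => by
    obtain ⟨s, -, h1, h2⟩ := hT t
    rw [h1, h2 ht]
  have hT1 : ∀ t, ‖T t‖ = 1 := fun t => by
    obtain ⟨s, hs, h1, -⟩ := hT t
    rw [h1, γ.unit s hs]
  have hsub : ∀ t ∈ Icc (m - r) (m + r), t ∈ Icc 0 γ.L := fun t ht =>
    ⟨h0.trans ht.1, ht.2.trans hL⟩
  set β : ℝ → ℝ := fun t => max 0 (r - |t - m|) with hβ
  have hβc : Continuous β := by fun_prop
  have hβ0 : ∀ t, 0 ≤ β t := fun t => le_max_left _ _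
  have hβr : ∀ t, β t ≤ r := fun t => max_le hr.le (by linarith [abs_nonneg (t - m)])
  have hβlip : ∀ x y, |β x - β y| ≤ |x - y| := fun x y => by
    have h1 := abs_max_sub_max_le_abs (r - |x - m|) (r - |y - m|) 0
    have h2 := abs_abs_sub_abs_le (y - m) (x - m)
    rw [sub_sub_sub_cancel_left] at h1
    rw [sub_sub_sub_cancel_right, abs_sub_comm y x] at h2
    simp only [hβ, max_comm (0 : ℝ)]
    exact h1.trans h2
  have hβl : ∀ t ≤ m - r, β t = 0 := fun t ht =>
    max_eq_left (by linarith [neg_abs_le (t - m)])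
  have hβu : ∀ t, m + r ≤ t → β t = 0 := fun t ht =>
    max_eq_left (by linarith [le_abs_self (t - m)])
  have hβpos : ∀ t ∈ Ioo (m - r) (m + r), 0 < β t := fun t ht =>
    lt_max_of_lt_right (by
      have : |t - m| < r := abs_lt.2 ⟨by linarith [ht.1], by linarith [ht.2]⟩
      linarith)
  have hLpos : 0 < γ.L := by linarith
  have hmmem : m ∈ Icc 0 γ.L := ⟨by linarith, by linarith⟩
  set B : ℝ := ∫ t in (0 : ℝ)..γ.L, β t with hB
  have hBpos : 0 < B := intervalIntegral.integral_pos hLpos hβc.continuousOn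
    (fun t _ => hβ0 t) ⟨m, hmmem, hβpos m ⟨by linarith, by linarith⟩⟩
  set c : Euc n := B⁻¹ • ∫ t in (0 : ℝ)..γ.L, β t • T t with hc
  have hBc : ∫ t in (0 : ℝ)..γ.L, β t • T t = B • c := by
    rw [hc, smul_inv_smul₀ hBpos.ne']
  have hc1 : ‖c‖ ≤ 1 := by
    have : ‖B • c‖ ≤ B := by
      rw [← hBc]
      refine (intervalIntegral.norm_integral_le_integral_norm hL0).trans_eq ?_
      refine intervalIntegral.integral_congr fun t _ => ?_
      simp [norm_smul, hT1, abs_of_nonneg (hβ0 t)]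
    rw [norm_smul, Real.norm_of_nonneg hBpos.le] at this
    nlinarith
  have hclt : ‖c‖ < 1 := by
    refine lt_of_le_of_ne hc1 fun hc1 => ?_
    obtain ⟨t, ht, htc⟩ : ∃ t ∈ Ioo (m - r) (m + r), T t ≠ c := by
      by_contra! H
      refine hne ?_
      rw [← hTeq _ (hsub _ (Ioo_subset_Icc_self hx₀)),
        ← hTeq _ (hsub _ (Ioo_subset_Icc_self hy₀)), H _ hx₀, H _ hy₀]
    have hle : ∀ t, ⟪c, T t⟫ ≤ 1 := fun t => by
      simpa [hc1, hT1] using real_inner_le_norm c (T t)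
    have hpos : 0 < ∫ t in (0 : ℝ)..γ.L, (β t - ⟪c, β t • T t⟫) := by
      refine intervalIntegral.integral_pos hLpos (by fun_prop) (fun t _ => ?_)
        ⟨t, hsub t (Ioo_subset_Icc_self ht), ?_⟩
      · rw [real_inner_smul_right]
        nlinarith [hle t, hβ0 t]
      · rw [real_inner_smul_right]
        have := (inner_lt_one_iff_real_of_norm_eq_one hc1 (hT1 t)).2 (Ne.symm htc)
        nlinarith [hβpos t ht]
    rw [intervalIntegral.integral_sub (hβc.intervalIntegrable _ _)
      (Continuous.intervalIntegrable (by fun_prop) _ _)] at hpos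
    have hin : ∫ t in (0 : ℝ)..γ.L, ⟪c, β t • T t⟫ = ⟪c, B • c⟫ := by
      rw [← hBc]
      exact (innerSL ℝ c).intervalIntegral_comp_comm
        (Continuous.intervalIntegrable (by fun_prop) _ _)
    rw [hin, real_inner_smul_right, real_inner_self_eq_norm_sq, hc1] at hpos
    simp [← hB] at hpos
  obtain ⟨ε, hε, hε1, hε2⟩ : ∃ ε > 0, 2 * ε * r < 1 ∧
      Λ' + 2 * ε < Λ * (1 - 2 * ε * r) ^ 2 := by
    have h1 : ∀ᶠ ε in 𝓝[>] (0 : ℝ), 2 * ε * r < 1 := by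
      refine nhdsWithin_le_nhds (ContinuousAt.eventually_lt ?_ continuousAt_const (by simp))
      fun_prop
    have h2 : ∀ᶠ ε in 𝓝[>] (0 : ℝ), Λ' + 2 * ε < Λ * (1 - 2 * ε * r) ^ 2 := by
      refine nhdsWithin_le_nhds (ContinuousAt.eventually_lt ?_ ?_ (by simpa using hΛ'))
      · fun_prop
      · fun_prop
    obtain ⟨ε, ⟨h1, h2⟩, h3⟩ := ((h1.and h2).and self_mem_nhdsWithin).exists
    exact ⟨ε, h3, h1, h2⟩
  set μ : ℝ := 1 - 2 * ε * r with hμ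
  have hμ0 : 0 < μ := by linarith
  set V : ℝ → Euc n := fun t => T t - (ε * β t) • (T t - c) with hV
  have hVc : Continuous V := by fun_prop
  have hεβ : ∀ t, 0 ≤ ε * β t := fun t => mul_nonneg hε.le (hβ0 t)
  have hεr : ∀ t, ε * β t ≤ ε * r := fun t => mul_le_mul_of_nonneg_left (hβr t) hε.le
  have hTc2 : ∀ t, ‖T t - c‖ ≤ 2 := fun t => by
    linarith [norm_sub_le (T t) c, hT1 t]
  have hVm : ∀ t, μ ≤ ‖V t‖ := fun t => by
    have h1 := norm_sub_norm_le (T t) ((ε * β t) • (T t - c))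
    rw [norm_smul, Real.norm_of_nonneg (hεβ t), hT1] at h1
    have h2 := mul_le_mul (hεr t) (hTc2 t) (norm_nonneg _) (by positivity)
    simp only [hV, hμ]
    linarith
  have hVle : ∀ t, ‖V t‖ ≤ 1 - (ε * (1 - ‖c‖)) * β t := fun t => by
    have h1 : V t = (1 - ε * β t) • T t + (ε * β t) • c := by
      simp only [hV]; module
    have h2 : 0 ≤ 1 - ε * β t := by linarith [hεr t, hεβ t]
    have := norm_add_le ((1 - ε * β t) • T t) ((ε * β t) • c)
    rw [norm_smul, norm_smul, Real.norm_of_nonneg h2, Real.norm_of_nonneg (hεβ t), hT1] at this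
    rw [h1]
    linarith
  have hVout : ∀ t, β t = 0 → V t = T t := fun t ht => by simp [hV, ht]
  have hVlip : ∀ x ∈ Icc (m - r) (m + r), ∀ y ∈ Icc (m - r) (m + r),
      ‖V x - V y‖ ≤ (Λ' + 2 * ε) * |x - y| := by
    intro x hx y hy
    have h1 : V x - V y = (1 - ε * β x) • (T x - T y) - (ε * (β x - β y)) • (T y - c) := by
      simp only [hV]; module
    have h2 : 0 ≤ 1 - ε * β x := by linarith [hεr x, hεβ x]
    have h3 := hlip x hx y hy
    rw [← hTeq x (hsub x hx), ← hTeq y (hsub y hy)] at h3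
    have h4 : ε * |β x - β y| * ‖T y - c‖ ≤ ε * |x - y| * 2 := by
      have := hβlip x y
      have := hTc2 y
      gcongr
    have h5 : (1 - ε * β x) * ‖T x - T y‖ ≤ 1 * ‖T x - T y‖ :=
      mul_le_mul_of_nonneg_right (by linarith [hεβ x]) (norm_nonneg _)
    rw [h1]
    refine (norm_sub_le _ _).trans ?_
    rw [norm_smul, norm_smul, Real.norm_of_nonneg h2, norm_mul, Real.norm_of_nonneg hε.le,
      Real.norm_eq_abs]
    linarith
  have hint : ∀ x y, IntervalIntegrable (fun t => ‖V t‖) volume x y := fun x y =>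
    hVc.norm.intervalIntegrable x y
  set σ : ℝ → ℝ := fun x => Λ * ∫ t in (0 : ℝ)..x, ‖V t‖ with hσ
  have hσsub : ∀ x y, σ y - σ x = Λ * ∫ t in x..y, ‖V t‖ := fun x y => by
    simp only [hσ]
    rw [← mul_sub, intervalIntegral.integral_interval_sub_left (hint _ _) (hint _ _)]
  have hout : ∀ x y, 0 ≤ x → x ≤ y → y ≤ γ.L → (∀ t ∈ Icc x y, β t = 0) →
      ‖‖V x‖⁻¹ • V x - ‖V y‖⁻¹ • V y‖ ≤ σ y - σ x := by
    intro x y hx hxy hy hb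
    have hint1 : ∫ t in x..y, ‖V t‖ = y - x := by
      rw [intervalIntegral.integral_congr (g := fun _ => (1 : ℝ))]
      · simp
      · intro t ht
        rw [uIcc_of_le hxy] at ht
        simp only [hVout t (hb t ht), hT1]
    have hxm : x ∈ Icc 0 γ.L := ⟨hx, hxy.trans hy⟩
    have hym : y ∈ Icc 0 γ.L := ⟨hx.trans hxy, hy⟩
    rw [hσsub, hint1, hVout x (hb x ⟨le_rfl, hxy⟩), hVout y (hb y ⟨hxy, le_rfl⟩), hT1, hT1,
      inv_one, one_smul, one_smul, hTeq x hxm, hTeq y hym]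
    have := γ.lip.dist_le_mul x hxm y hym
    rwa [dist_eq_norm, Real.dist_eq, Real.coe_toNNReal _ hΛ.le, abs_sub_comm,
      abs_of_nonneg (sub_nonneg.2 hxy)] at this
  have hmid : ∀ x y, m - r ≤ x → x ≤ y → y ≤ m + r →
      ‖‖V x‖⁻¹ • V x - ‖V y‖⁻¹ • V y‖ ≤ σ y - σ x := by
    intro x y hx hxy hy
    have h1 := mul_norm_normalize_sub_le hμ0 (hVm x) (hVm y)
    have h2 := hVlip x ⟨hx, hxy.trans hy⟩ y ⟨hx.trans hxy, hy⟩
    rw [abs_sub_comm, abs_of_nonneg (sub_nonneg.2 hxy)] at h2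
    have h3 : μ * (y - x) ≤ ∫ t in x..y, ‖V t‖ := by
      have := intervalIntegral.integral_mono_on hxy (intervalIntegrable_const (μ := volume) (c := μ))
        (hint x y) (fun t _ => hVm t)
      simpa [mul_comm] using this
    have h4 : (Λ' + 2 * ε) * (y - x) ≤ Λ * μ ^ 2 * (y - x) :=
      mul_le_mul_of_nonneg_right hε2.le (sub_nonneg.2 hxy)
    have h5 := mul_le_mul_of_nonneg_left h3 hΛ.le
    rw [hσsub]
    refine le_trans ?_ h5
    refine le_of_mul_le_mul_left ?_ hμ0
    linarith
  have hall := norm_sub_le_of_adjacent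
    (norm_sub_le_of_adjacent
      (fun x y hx hxy hy => hout x y hx hxy (by linarith) fun t ht => hβl t (ht.2.trans hy)) hmid)
    (fun x y hx hxy hy => hout x y (by linarith) hxy hy fun t ht => hβu t (hx.trans ht.1))
  have hTint : p + ∫ t in (0 : ℝ)..γ.L, T t = q := by
    have := intervalIntegral.integral_eq_sub_of_hasDerivAt_of_le hL0
      (f := γ.f) (f' := T) (fun s hs => (γ.deriv s hs).continuousWithinAt)
      (fun s hs => by
        rw [hTeq s (Ioo_subset_Icc_self hs)]
        exact (γ.deriv s (Ioo_subset_Icc_self hs)).hasDerivAt (Icc_mem_nhds hs.1 hs.2))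
      (hTc.intervalIntegrable _ _)
    rw [this, γ.iL, γ.i0]
    abel
  have hVint : p + ∫ t in (0 : ℝ)..γ.L, V t = q := by
    have h1 : ∀ t, V t = T t - ε • (β t • T t - β t • c) := fun t => by
      simp only [hV]; module
    simp only [h1]
    rw [intervalIntegral.integral_sub (hTc.intervalIntegrable _ _)
        (Continuous.intervalIntegrable (by fun_prop) _ _), intervalIntegral.integral_smul,
      intervalIntegral.integral_sub (Continuous.intervalIntegrable (by fun_prop) _ _)
        (Continuous.intervalIntegrable (by fun_prop) _ _), hBc,
      intervalIntegral.integral_smul_const, ← hB, sub_self, smul_zero, sub_zero, hTint]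
  obtain ⟨η, hη⟩ := exists_curveCC_of_velocity (v := v) (w := w) hΛ.le hL0 hμ0 hVc hVm
    (by rw [hVout 0 (hβl 0 h0), hTeq 0 ⟨le_rfl, hL0⟩, γ.id0])
    (by rw [hVout _ (hβu _ hL), hTeq _ ⟨hL0, le_rfl⟩, γ.idL]) hv hw hVint
    (fun x y hx hxy hy => hσsub x y ▸ hall x y hx hxy hy)
  refine ⟨η, ?_⟩
  have hlen := intervalIntegral.integral_mono_on hL0 (hint 0 γ.L)
    (Continuous.intervalIntegrable (u := fun t => 1 - (ε * (1 - ‖c‖)) * β t) (by fun_prop) _ _)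
    (fun t _ => hVle t)
  rw [intervalIntegral.integral_sub intervalIntegrable_const
    (Continuous.intervalIntegrable (by fun_prop) _ _), intervalIntegral.integral_const_mul,
    ← hB] at hlen
  have : 0 < ε * (1 - ‖c‖) * B := by
    have : 0 < 1 - ‖c‖ := by linarith
    positivity
  rw [hη]
  simp only [intervalIntegral.integral_const, sub_zero, smul_eq_mul, mul_one] at hlen
  linarith

theorem curvAt_le {n : ℕ} {γd : ℝ → Euc n} {D : Set ℝ} {s M δ : ℝ} (hM : 0 ≤ M) (hδ : 0 < δ)
    (h : ∀ x ∈ D, ∀ y ∈ D, x ≠ y → |x - s| < δ → |y - s| < δ →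
      InnerProductGeometry.angle (γd x) (γd y) ≤ M * |x - y|) : curvAt γd D s ≤ M :=
  csInf_le ⟨0, fun _ h => h.1⟩ ⟨hM, δ, hδ, h⟩

theorem curvAt_nonneg {n : ℕ} (γd : ℝ → Euc n) (D : Set ℝ) (s : ℝ) : 0 ≤ curvAt γd D s :=
  Real.sInf_nonneg fun _ h => h.1

/-- A unit vector field that is `Λ`-Lipschitz for the chordal distance has angle dilation
locally bounded by any `M > Λ`. -/
theorem exists_angle_le_of_lipschitzOn {n : ℕ} {γd : ℝ → Euc n} {D : Set ℝ} {Λ M : ℝ}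
    (hΛ : 0 < Λ) (hM : Λ < M) (hunit : ∀ x ∈ D, ‖γd x‖ = 1)
    (hlip : ∀ x ∈ D, ∀ y ∈ D, ‖γd x - γd y‖ ≤ Λ * |x - y|) (s : ℝ) :
    ∃ δ > 0, ∀ x ∈ D, ∀ y ∈ D, x ≠ y → |x - s| < δ → |y - s| < δ →
      InnerProductGeometry.angle (γd x) (γd y) ≤ M * |x - y| := by
  have hM0 : 0 < M := hΛ.trans hM
  refine ⟨(M - Λ) / (M * Λ), div_pos (by linarith) (by positivity), ?_⟩
  intro x hx y hy _ hxs hys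
  set θ := InnerProductGeometry.angle (γd x) (γd y) with hθ
  have hθ0 : 0 ≤ θ := InnerProductGeometry.angle_nonneg _ _
  have h1 : θ * (1 - ‖γd x - γd y‖ / 2) ≤ ‖γd x - γd y‖ :=
    angle_mul_one_sub_half_norm_sub_le (hunit x hx) (hunit y hy)
  have h2 := hlip x hx y hy
  have h3 : |x - y| ≤ 2 * ((M - Λ) / (M * Λ)) := by
    have := abs_sub_le x s y
    rw [abs_sub_comm s y] at this
    linarith
  have h4 : Λ * ((M - Λ) / (M * Λ)) = 1 - Λ / M := by field_simp
  have h5 : Λ / M ≤ 1 - ‖γd x - γd y‖ / 2 := by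
    have := mul_le_mul_of_nonneg_left h3 hΛ.le
    linarith
  have h6 : θ * (Λ / M) ≤ Λ * |x - y| := (mul_le_mul_of_nonneg_left h5 hθ0).trans (h1.trans h2)
  have h7 : θ * (Λ / M) = Λ * (θ / M) := by ring
  rw [h7] at h6
  have h8 := le_of_mul_le_mul_left h6 hΛ
  rwa [div_le_iff₀ hM0, mul_comm] at h8

/-- On a length-minimizer in `C(p,q;v,w;Λ)`, the curvature takes only the
values `0` and `Λ`; the set where it equals `Λ` is closed in `[0,L]`, and around any point of
curvature `< Λ` the derivative is locally constant (the curve is locally a line segment). -/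
theorem statement_13 {n : ℕ} (hn : 2 ≤ n) (p q v w : Euc n)
    (hv : ‖v‖ = 1) (hw : ‖w‖ = 1) (Λ : ℝ) (hΛ : 0 < Λ)
    (γ : CurveCC n p q v w Λ)
    (hmin : ∀ η : CurveCC n p q v w Λ, γ.L ≤ η.L) :
    (∀ s ∈ Set.Icc (0 : ℝ) γ.L,
      curvAt γ.fd (Set.Icc 0 γ.L) s = 0 ∨ curvAt γ.fd (Set.Icc 0 γ.L) s = Λ) ∧
    IsClosed {s : ℝ | s ∈ Set.Icc (0 : ℝ) γ.L ∧ curvAt γ.fd (Set.Icc 0 γ.L) s = Λ} ∧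
    (∀ s ∈ Set.Icc (0 : ℝ) γ.L, curvAt γ.fd (Set.Icc 0 γ.L) s < Λ →
      ∃ ε > 0, ∀ x ∈ Set.Icc (0 : ℝ) γ.L, ∀ y ∈ Set.Icc (0 : ℝ) γ.L,
        |x - s| < ε → |y - s| < ε → γ.fd x = γ.fd y) := by
  set D := Set.Icc (0 : ℝ) γ.L with hD
  have hlip : ∀ x ∈ D, ∀ y ∈ D, ‖γ.fd x - γ.fd y‖ ≤ Λ * |x - y| := fun x hx y hy => by
    have := γ.lip.dist_le_mul x hx y hy
    rwa [dist_eq_norm, Real.dist_eq, Real.coe_toNNReal _ hΛ.le] at this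
  have hbound : ∀ M, Λ < M → ∀ s, ∃ δ > 0, ∀ x ∈ D, ∀ y ∈ D, x ≠ y → |x - s| < δ →
      |y - s| < δ → InnerProductGeometry.angle (γ.fd x) (γ.fd y) ≤ M * |x - y| :=
    fun M hM s => exists_angle_le_of_lipschitzOn hΛ hM γ.unit hlip s
  have hle : ∀ s, curvAt γ.fd D s ≤ Λ := fun s =>
    le_of_forall_gt_imp_ge_of_dense fun M hM => by
      obtain ⟨δ, hδ, h⟩ := hbound M hM s
      exact curvAt_le (hΛ.le.trans hM.le) hδ h
  have hlt : ∀ s, curvAt γ.fd D s < Λ → ∃ Λ' < Λ, 0 ≤ Λ' ∧ ∃ δ > 0, ∀ x ∈ D, ∀ y ∈ D, x ≠ y →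
      |x - s| < δ → |y - s| < δ →
      InnerProductGeometry.angle (γ.fd x) (γ.fd y) ≤ Λ' * |x - y| := fun s hs => by
    obtain ⟨δ, hδ, h⟩ := hbound (Λ + 1) (by linarith) s
    have hne : {M : ℝ | 0 ≤ M ∧ ∃ δ > 0, ∀ x ∈ D, ∀ y ∈ D, x ≠ y → |x - s| < δ → |y - s| < δ →
        InnerProductGeometry.angle (γ.fd x) (γ.fd y) ≤ M * |x - y|}.Nonempty :=
      ⟨Λ + 1, by positivity, δ, hδ, h⟩
    obtain ⟨Λ', h1, h2⟩ := exists_lt_of_csInf_lt hne hs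
    exact ⟨Λ', h2, h1⟩
  have hconst : ∀ s ∈ D, curvAt γ.fd D s < Λ → ∃ ε > 0, ∀ x ∈ D, ∀ y ∈ D,
      |x - s| < ε → |y - s| < ε → γ.fd x = γ.fd y := by
    intro s hs hsΛ
    obtain ⟨Λ', hΛ', -, δ, hδ, h⟩ := hlt s hsΛ
    refine ⟨δ / 2, by positivity, ?_⟩
    rcases γ.Lnn.eq_or_lt with hL | hL
    · intro x hx y hy _ _
      rw [hD, ← hL, Icc_self, mem_singleton_iff] at hx hy
      rw [hx, hy]
    set a := max 0 (s - δ / 2) with ha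
    set b := min γ.L (s + δ / 2) with hb
    have ha0 : 0 ≤ a := le_max_left _ _
    have has : s - δ / 2 ≤ a := le_max_right _ _
    have hbL : b ≤ γ.L := min_le_left _ _
    have hbs : b ≤ s + δ / 2 := min_le_right _ _
    have hab : a < b := max_lt (lt_min hL (by linarith [hs.1])) (lt_min (by linarith [hs.2])
      (by linarith))
    have hIoo : ∀ x ∈ Ioo a b, ∀ y ∈ Ioo a b, γ.fd x = γ.fd y := by
      intro x hx y hy
      by_contra hne
      have hl : (a + b) / 2 - (b - a) / 2 = a := by ring
      have hu : (a + b) / 2 + (b - a) / 2 = b := by ring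
      obtain ⟨η, hη⟩ := γ.exists_shorter hv hw hΛ hΛ' (m := (a + b) / 2) (r := (b - a) / 2)
        (by linarith) (by linarith) (by linarith)
        (by
          rw [hl, hu]
          intro x hx y hy
          rcases eq_or_ne x y with rfl | hxy
          · simp
          have hxD : x ∈ D := ⟨ha0.trans hx.1, hx.2.trans hbL⟩
          have hyD : y ∈ D := ⟨ha0.trans hy.1, hy.2.trans hbL⟩
          exact (norm_sub_le_angle_s13 (γ.unit x hxD) (γ.unit y hyD)).trans
            (h x hxD y hyD hxy
              (abs_lt.2 ⟨by linarith [hx.1], by linarith [hx.2]⟩)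
              (abs_lt.2 ⟨by linarith [hy.1], by linarith [hy.2]⟩)))
        (by rwa [hl, hu]) (by rwa [hl, hu]) hne
      exact (hmin η).not_gt hη
    have hIcc : ∀ x ∈ Icc a b, γ.fd x = γ.fd ((a + b) / 2) := by
      have hcont : ContinuousOn γ.fd (closure (Ioo a b)) := by
        rw [closure_Ioo hab.ne]
        exact γ.lip.continuousOn.mono (Icc_subset_Icc ha0 hbL)
      have hmid : EqOn γ.fd (fun _ => γ.fd ((a + b) / 2)) (Ioo a b) := fun x hx =>
        hIoo x hx _ ⟨by linarith, by linarith⟩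
      have := hmid.of_subset_closure hcont continuousOn_const subset_closure subset_rfl
      rwa [closure_Ioo hab.ne] at this
    have hmem : ∀ x ∈ D, |x - s| < δ / 2 → x ∈ Icc a b := fun x hx hxs => by
      rw [abs_lt] at hxs
      exact ⟨max_le hx.1 (by linarith), le_min hx.2 (by linarith)⟩
    intro x hx y hy hxs hys
    rw [hIcc x (hmem x hx hxs), hIcc y (hmem y hy hys)]
  refine ⟨fun s hs => ?_, ?_, hconst⟩
  · rcases (hle s).lt_or_eq with h | h
    · left
      obtain ⟨ε, hε, hc⟩ := hconst s hs h
      refine le_antisymm (curvAt_le le_rfl hε fun x hx y hy _ hxs hys => ?_) (curvAt_nonneg _ _ _)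
      rw [hc x hx y hy hxs hys, InnerProductGeometry.angle_self, zero_mul]
      exact norm_ne_zero_iff.1 (by rw [γ.unit y hy]; exact one_ne_zero)
    · exact Or.inr h
  · have hset : {s : ℝ | s ∈ D ∧ curvAt γ.fd D s = Λ} = D \ {s | curvAt γ.fd D s < Λ} := by
      ext s
      rw [Set.mem_sdiff, mem_ofPred_eq, mem_ofPred_eq, not_lt]
      exact and_congr_right fun _ => ⟨fun h => h.ge, fun h => (hle s).antisymm h⟩
    rw [hset]
    refine isClosed_Icc.sdiff (Metric.isOpen_iff.2 fun s hs => ?_)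
    obtain ⟨Λ', hΛ', h0, δ, hδ, h⟩ := hlt s hs
    refine ⟨δ / 2, by positivity, fun t ht => ?_⟩
    rw [Metric.mem_ball, Real.dist_eq] at ht
    have hnear : ∀ x, |x - t| < δ / 2 → |x - s| < δ := fun x hx => by
      linarith [abs_sub_le x t s]
    exact (curvAt_le h0 (half_pos hδ) fun x hx y hy hxy hxt hyt =>
      h x hx y hy hxy (hnear x hxt) (hnear y hyt)).trans_lt hΛ'
end
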